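/- Let p_{Y1,Y2|X} be a discrete memoryless broadcast channel whose marginal channels p_{Y1|X} and p_{Y2|X} are binary symmetric channels with crossover probabilities p1 and p2 respectively, where 0 ≤ p1 ≤ p2 ≤ 1/2. Then: (i) 𝒞₁(p_{Y1,Y2|X}) = 𝒞(p_{Y1,Y2|X}) = {(R1,R2) ∈ ℝ²₊ : ∃α ∈ [0,1/2], R1 ≤ H_b(α*p1) − H_b(p1) and R2 ≤ 1 − H_b(α*p2)}; (ii) 𝒞₂(p_{Y1,Y2|X}) = {(R1,R2) ∈ ℝ²₊ : R2 ≤ 1 − H_b(p2) and R1+R2 ≤ 1 − H_b(p1)}. -/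

import Mathlib

open scoped BigOperators Classical
open Finset

noncomputable section

/-- `p` is a probability mass function on the finite type `α`. -/
def IsPMF {α : Type} [Fintype α] (p : α → ℝ) : Prop :=
  (∀ a, 0 ≤ p a) ∧ ∑ a, p a = 1

/-- Shannon entropy (base 2) of a pmf on a finite type. -/
def Hent {α : Type} [Fintype α] (p : α → ℝ) : ℝ :=
  -∑ a, p a * Real.logb 2 (p a)

/-- Mutual information `I(A;B)` of a joint pmf on `α × β` (base-2 logarithms). -/
def MI {α β : Type} [Fintype α] [Fintype β] (p : α × β → ℝ) : ℝ :=
  Hent (fun a => ∑ b, p (a, b)) + Hent (fun b => ∑ a, p (a, b)) - Hent p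

/-- Conditional mutual information `I(A;B|C)` of a joint pmf on `α × β × γ`. -/
def CMI {α β γ : Type} [Fintype α] [Fintype β] [Fintype γ] (p : α × β × γ → ℝ) : ℝ :=
  Hent (fun ac : α × γ => ∑ b, p (ac.1, b, ac.2))
    + Hent (fun bc : β × γ => ∑ a, p (a, bc.1, bc.2))
    - Hent p
    - Hent (fun c : γ => ∑ a, ∑ b, p (a, b, c))

/-- A channel: every input letter gives a pmf on outputs. -/
def IsChannel {X Z : Type} [Fintype Z] (W : X → Z → ℝ) : Prop :=
  ∀ x, IsPMF (W x)

/-- Marginal channel to receiver 1 of a broadcast channel. -/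
def margW1 {X Y1 Y2 : Type} [Fintype Y2] (W : X → Y1 × Y2 → ℝ) : X → Y1 → ℝ :=
  fun x y1 => ∑ y2, W x (y1, y2)

/-- Marginal channel to receiver 2 of a broadcast channel. -/
def margW2 {X Y1 Y2 : Type} [Fintype Y1] (W : X → Y1 × Y2 → ℝ) : X → Y2 → ℝ :=
  fun x y2 => ∑ y1, W x (y1, y2)

/-- Memoryless `n`-fold extension of a broadcast channel. -/
def nFold {X Y1 Y2 : Type} (W : X → Y1 × Y2 → ℝ) (n : ℕ)
    (x : Fin n → X) (y : (Fin n → Y1) × (Fin n → Y2)) : ℝ :=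
  ∏ t, W (x t) (y.1 t, y.2 t)

section Channel

variable {X Y1 Y2 : Type} [Fintype Y1] [Fintype Y2]

/-- Average error probability; message `M2` known at receiver 1. -/
def errP1 (W : X → Y1 × Y2 → ℝ) (n k1 k2 : ℕ) (f : Fin k1 × Fin k2 → Fin n → X)
    (g1 : (Fin n → Y1) × Fin k2 → Fin k1) (g2 : (Fin n → Y2) → Fin k2) : ℝ :=
  (1 : ℝ) / ((k1 : ℝ) * (k2 : ℝ)) *
    ∑ m : Fin k1 × Fin k2, ∑ y : (Fin n → Y1) × (Fin n → Y2),
      nFold W n (f m) y * (if g1 (y.1, m.2) = m.1 ∧ g2 y.2 = m.2 then 0 else 1)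

/-- Average error probability; message `M1` known at receiver 2. -/
def errP2 (W : X → Y1 × Y2 → ℝ) (n k1 k2 : ℕ) (f : Fin k1 × Fin k2 → Fin n → X)
    (g1 : (Fin n → Y1) → Fin k1) (g2 : (Fin n → Y2) × Fin k1 → Fin k2) : ℝ :=
  (1 : ℝ) / ((k1 : ℝ) * (k2 : ℝ)) *
    ∑ m : Fin k1 × Fin k2, ∑ y : (Fin n → Y1) × (Fin n → Y2),
      nFold W n (f m) y * (if g1 y.1 = m.1 ∧ g2 (y.2, m.1) = m.2 then 0 else 1)

/-- Average error probability; no receiver side information. -/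
def errP0 (W : X → Y1 × Y2 → ℝ) (n k1 k2 : ℕ) (f : Fin k1 × Fin k2 → Fin n → X)
    (g1 : (Fin n → Y1) → Fin k1) (g2 : (Fin n → Y2) → Fin k2) : ℝ :=
  (1 : ℝ) / ((k1 : ℝ) * (k2 : ℝ)) *
    ∑ m : Fin k1 × Fin k2, ∑ y : (Fin n → Y1) × (Fin n → Y2),
      nFold W n (f m) y * (if g1 y.1 = m.1 ∧ g2 y.2 = m.2 then 0 else 1)

/-- Achievability of a rate pair with `M2` available at receiver 1. -/
def Ach1 (W : X → Y1 × Y2 → ℝ) (R : ℝ × ℝ) : Prop :=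
  0 ≤ R.1 ∧ 0 ≤ R.2 ∧ ∀ ε : ℝ, 0 < ε →
    ∃ (n k1 k2 : ℕ), 0 < n ∧ 0 < k1 ∧ 0 < k2 ∧
      ∃ (f : Fin k1 × Fin k2 → Fin n → X) (g1 : (Fin n → Y1) × Fin k2 → Fin k1)
        (g2 : (Fin n → Y2) → Fin k2),
        R.1 ≤ Real.logb 2 (k1 : ℝ) / (n : ℝ) ∧ R.2 ≤ Real.logb 2 (k2 : ℝ) / (n : ℝ) ∧
        errP1 W n k1 k2 f g1 g2 ≤ ε

/-- Achievability of a rate pair with `M1` available at receiver 2. -/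
def Ach2 (W : X → Y1 × Y2 → ℝ) (R : ℝ × ℝ) : Prop :=
  0 ≤ R.1 ∧ 0 ≤ R.2 ∧ ∀ ε : ℝ, 0 < ε →
    ∃ (n k1 k2 : ℕ), 0 < n ∧ 0 < k1 ∧ 0 < k2 ∧
      ∃ (f : Fin k1 × Fin k2 → Fin n → X) (g1 : (Fin n → Y1) → Fin k1)
        (g2 : (Fin n → Y2) × Fin k1 → Fin k2),
        R.1 ≤ Real.logb 2 (k1 : ℝ) / (n : ℝ) ∧ R.2 ≤ Real.logb 2 (k2 : ℝ) / (n : ℝ) ∧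
        errP2 W n k1 k2 f g1 g2 ≤ ε

/-- Achievability of a rate pair with no receiver side information. -/
def Ach0 (W : X → Y1 × Y2 → ℝ) (R : ℝ × ℝ) : Prop :=
  0 ≤ R.1 ∧ 0 ≤ R.2 ∧ ∀ ε : ℝ, 0 < ε →
    ∃ (n k1 k2 : ℕ), 0 < n ∧ 0 < k1 ∧ 0 < k2 ∧
      ∃ (f : Fin k1 × Fin k2 → Fin n → X) (g1 : (Fin n → Y1) → Fin k1)
        (g2 : (Fin n → Y2) → Fin k2),
        R.1 ≤ Real.logb 2 (k1 : ℝ) / (n : ℝ) ∧ R.2 ≤ Real.logb 2 (k2 : ℝ) / (n : ℝ) ∧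
        errP0 W n k1 k2 f g1 g2 ≤ ε

/-- Capacity region `𝒞₁`: side information `M2` at receiver 1. -/
def Cap1 (W : X → Y1 × Y2 → ℝ) : Set (ℝ × ℝ) := closure {R | Ach1 W R}

/-- Capacity region `𝒞₂`: side information `M1` at receiver 2. -/
def Cap2 (W : X → Y1 × Y2 → ℝ) : Set (ℝ × ℝ) := closure {R | Ach2 W R}

/-- Private-message capacity region `𝒞`. -/
def Cap (W : X → Y1 × Y2 → ℝ) : Set (ℝ × ℝ) := closure {R | Ach0 W R}

end Channel

/-- `κ·𝒜` for a set of rate pairs. -/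
def scaleSet (κ : ℝ) (A : Set (ℝ × ℝ)) : Set (ℝ × ℝ) :=
  (fun R : ℝ × ℝ => (κ * R.1, κ * R.2)) '' A

/-- Binary entropy function (base 2). -/
def Hb (x : ℝ) : ℝ := -(x * Real.logb 2 x) - (1 - x) * Real.logb 2 (1 - x)

/-- Binary convolution `a*b = a(1-b)+(1-a)b`. -/
def bconv (a b : ℝ) : ℝ := a * (1 - b) + (1 - a) * b

/-- The region `𝒞(BS-BC(d₁,d₂))`. -/
def CBSBC (d1 d2 : ℝ) : Set (ℝ × ℝ) :=
  {R | 0 ≤ R.1 ∧ 0 ≤ R.2 ∧ ∃ α ∈ Set.Icc (0:ℝ) (1/2),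
    R.1 ≤ Hb (bconv α d1) - Hb d1 ∧ R.2 ≤ 1 - Hb (bconv α d2)}

/-- The region `𝒞(BE-BC(ε₁,ε₂))`. -/
def CBEBC (e1 e2 : ℝ) : Set (ℝ × ℝ) :=
  {R | 0 ≤ R.1 ∧ 0 ≤ R.2 ∧ ∃ β ∈ Set.Icc (0:ℝ) 1,
    R.1 ≤ β * (1 - e1) ∧ R.2 ≤ (1 - β) * (1 - e2)}

/-- 1-norm distance between two functions on a finite type. -/
def l1dist {α : Type} [Fintype α] (p q : α → ℝ) : ℝ := ∑ a, |p a - q a|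

/-- Capacity `C(p_{Y|X}) = max_{p_X} I(X;Y)` of a point-to-point channel. -/
def Cmarg {X Y : Type} [Fintype X] [Fintype Y] (Wm : X → Y → ℝ) : ℝ :=
  sSup {r | ∃ pX : X → ℝ, IsPMF pX ∧ r = MI (fun a : X × Y => pX a.1 * Wm a.1 a.2)}

/-- Transition kernel of the binary symmetric channel `BSC(p)`. -/
def BSCk (p : ℝ) : Bool → Bool → ℝ := fun x y => if y = x then 1 - p else p

/-- Transition kernel of the binary erasure channel `BEC(ε)`
(`none` is the erasure symbol). -/
def BECk (e : ℝ) : Bool → Option Bool → ℝ :=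
  fun x y => match y with
    | none => e
    | some b => if b = x then 1 - e else 0

/-! ### Part A: scalar Gerber inequality -/

/-- Twice the inverse hyperbolic tangent. -/
def AA (x : ℝ) : ℝ := Real.log (1 + x) - Real.log (1 - x)

lemma AA_deriv {x : ℝ} (h0 : -1 < x) (h1 : x < 1) : HasDerivAt AA (2 / (1 - x ^ 2)) x := by
  have e1 : (1 + x) ≠ 0 := by linarith
  have e2 : (1 - x) ≠ 0 := by linarith
  have e3 : (1 - x ^ 2) ≠ 0 := by
    have : (1 - x ^ 2) = (1 + x) * (1 - x) := by ring
    rw [this]; exact mul_ne_zero e1 e2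
  have h := ((hasDerivAt_id x).const_add 1).log e1
  have h' := ((hasDerivAt_id x).const_sub 1).log e2
  have := h.sub h'
  refine this.congr_deriv ?_
  simp only [id]
  field_simp
  ring

@[simp] lemma AA_zero : AA 0 = 0 := by simp [AA]

lemma AA_mono : MonotoneOn AA (Set.Ico 0 1) := by
  intro x hx y hy hxy
  unfold AA
  have h1 : Real.log (1 + x) ≤ Real.log (1 + y) := Real.log_le_log (by linarith [hx.1]) (by linarith)
  have h2 : Real.log (1 - y) ≤ Real.log (1 - x) := Real.log_le_log (by linarith [hy.2]) (by linarith)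
  linarith

lemma AA_nonneg {x : ℝ} (h0 : 0 ≤ x) (h1 : x < 1) : 0 ≤ AA x := by
  have := AA_mono (⟨le_refl _, one_pos⟩ : (0:ℝ) ∈ Set.Ico 0 1) ⟨h0, h1⟩ h0
  simpa using this

lemma AA_pos {x : ℝ} (h0 : 0 < x) (h1 : x < 1) : 0 < AA x := by
  unfold AA
  have h1 : Real.log (1 - x) < Real.log (1 + x) := Real.log_lt_log (by linarith) (by linarith)
  linarith

lemma phi_concave : ConcaveOn ℝ (Set.Ico 0 1) (fun t => (1 - t ^ 2) * AA t) := by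
  have hd : ∀ t ∈ Set.Ioo (-1:ℝ) 1, HasDerivAt (fun t => (1 - t ^ 2) * AA t) (2 - 2 * t * AA t) t := by
    intro t ht
    have e3 : (1 - t ^ 2) ≠ 0 := by nlinarith [ht.1, ht.2]
    have := (((hasDerivAt_id t).pow 2).const_sub 1).mul (AA_deriv ht.1 ht.2)
    refine this.congr_deriv ?_
    simp only [id]
    field_simp
    simp
    ring
  apply AntitoneOn.concaveOn_of_deriv (convex_Ico 0 1)
  · intro t ht
    exact (hd t ⟨by linarith [ht.1], ht.2⟩).continuousAt.continuousWithinAt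
  · intro t ht
    rw [interior_Ico] at ht
    exact (hd t ⟨by linarith [ht.1], ht.2⟩).differentiableAt.differentiableWithinAt
  · intro x hx y hy hxy
    rw [interior_Ico] at hx hy
    rw [(hd x ⟨by linarith [hx.1], hx.2⟩).deriv, (hd y ⟨by linarith [hy.1], hy.2⟩).deriv]
    have h1 := AA_mono ⟨hx.1.le, hx.2⟩ ⟨hy.1.le, hy.2⟩ hxy
    have h2 := AA_nonneg hx.1.le hx.2
    have := mul_le_mul hxy h1 h2 hy.1.le
    linarith

lemma AA_convex : ConvexOn ℝ (Set.Ico 0 1) AA := by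
  apply MonotoneOn.convexOn_of_deriv (convex_Ico 0 1)
  · intro t ht
    exact (AA_deriv (by linarith [ht.1]) ht.2).continuousAt.continuousWithinAt
  · intro t ht
    rw [interior_Ico] at ht
    exact (AA_deriv (by linarith [ht.1]) ht.2).differentiableAt.differentiableWithinAt
  · intro x hx y hy hxy
    rw [interior_Ico] at hx hy
    rw [(AA_deriv (by linarith [hx.1]) hx.2).deriv, (AA_deriv (by linarith [hy.1]) hy.2).deriv]
    apply div_le_div_of_nonneg_left (by norm_num)
    · nlinarith [hy.1, hy.2]
    · nlinarith [hx.1]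

lemma AA_smul {c x : ℝ} (hc0 : 0 ≤ c) (hc1 : c ≤ 1) (h0 : 0 ≤ x) (h1 : x < 1) :
    AA (c * x) ≤ c * AA x := by
  have := AA_convex.2 (⟨le_refl _, one_pos⟩ : (0:ℝ) ∈ Set.Ico 0 1) ⟨h0, h1⟩
    (sub_nonneg.2 hc1) hc0 (by ring)
  simpa using this

lemma phi_smul {c x : ℝ} (hc0 : 0 ≤ c) (hc1 : c ≤ 1) (h0 : 0 ≤ x) (h1 : x < 1) :
    c * ((1 - x ^ 2) * AA x) ≤ (1 - (c * x) ^ 2) * AA (c * x) := by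
  have := phi_concave.2 (⟨le_refl _, one_pos⟩ : (0:ℝ) ∈ Set.Ico 0 1) ⟨h0, h1⟩
    (sub_nonneg.2 hc1) hc0 (by ring)
  simpa using this

lemma ratio_anti {c : ℝ} (hc0 : 0 ≤ c) (hc1 : c ≤ 1) :
    AntitoneOn (fun x => AA (c * x) / AA x) (Set.Ioo 0 1) := by
  have hd : ∀ x ∈ Set.Ioo (0:ℝ) 1, HasDerivAt (fun x => AA (c * x) / AA x)
      ((2 / (1 - (c * x) ^ 2) * c * AA x - AA (c * x) * (2 / (1 - x ^ 2))) / (AA x) ^ 2) x := by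
    intro x hx
    have hcx0 : 0 ≤ c * x := mul_nonneg hc0 hx.1.le
    have hcx1 : c * x < 1 := by nlinarith [hx.1, hx.2]
    have h1 : HasDerivAt (fun x => AA (c * x)) (2 / (1 - (c * x) ^ 2) * c) x := by
      have := (AA_deriv (x := c * x) (by linarith) hcx1).comp x ((hasDerivAt_id x).const_mul c)
      simpa [Function.comp_def] using this
    exact h1.div (AA_deriv (by linarith [hx.1]) hx.2) (AA_pos hx.1 hx.2).ne'
  apply antitoneOn_of_deriv_nonpos (convex_Ioo 0 1)
  · intro t ht
    exact (hd t ht).continuousAt.continuousWithinAt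
  · intro t ht
    rw [interior_Ioo] at ht
    exact (hd t ht).differentiableAt.differentiableWithinAt
  · intro x hx
    rw [interior_Ioo] at hx
    rw [(hd x hx).deriv]
    have hcx0 : 0 ≤ c * x := mul_nonneg hc0 hx.1.le
    have hcx1 : c * x < 1 := by nlinarith [hx.1, hx.2]
    have e1 : 0 < 1 - x ^ 2 := by nlinarith [hx.1, hx.2]
    have e2 : 0 < 1 - (c * x) ^ 2 := by nlinarith
    have := phi_smul hc0 hc1 hx.1.le hx.2
    apply div_nonpos_of_nonpos_of_nonneg _ (sq_nonneg _)
    have : 2 / (1 - (c * x) ^ 2) * c * AA x - AA (c * x) * (2 / (1 - x ^ 2))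
      = 2 * (c * ((1 - x ^ 2) * AA x) - (1 - (c * x) ^ 2) * AA (c * x)) / ((1 - (c * x) ^ 2) * (1 - x ^ 2)) := by
      rw [div_mul_eq_mul_div, div_mul_eq_mul_div, mul_div_assoc', div_sub_div _ _ e2.ne' e1.ne']
      congr 1; ring
    rw [this]
    apply div_nonpos_of_nonpos_of_nonneg (by linarith) (by positivity)

lemma bE_deriv {c x : ℝ} (h0 : -1 < c * x) (h1 : c * x < 1) :
    HasDerivAt (fun x => Real.binEntropy ((1 - c * x) / 2)) (-(c / 2 * AA (c * x))) x := by
  have h := (Real.hasDerivAt_binEntropy (p := (1 - c * x) / 2) (by linarith) (by linarith))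
  have h2 : HasDerivAt (fun x => (1 - c * x) / 2) (-c / 2) x := by
    have := (((hasDerivAt_id x).const_mul c).const_sub 1).div_const 2
    simpa using this
  have := h.comp x h2
  refine this.congr_deriv ?_
  unfold AA
  have e1 : 1 - (1 - c * x) / 2 = (1 + c * x) / 2 := by ring
  rw [e1, Real.log_div (by linarith) (by norm_num), Real.log_div (by linarith) (by norm_num)]
  ring

lemma E_deriv {c lam x : ℝ} (hc0 : 0 ≤ c) (hc1 : c ≤ 1) (h0 : 0 < x) (h1 : x < 1) :
    HasDerivAt (fun x => Real.binEntropy ((1 - c * x) / 2) - lam * Real.binEntropy ((1 - x) / 2))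
      (-(c / 2 * AA (c * x)) + lam / 2 * AA x) x := by
  have hcx0 : 0 ≤ c * x := mul_nonneg hc0 h0.le
  have hcx1 : c * x < 1 := by nlinarith
  have a := bE_deriv (c := c) (x := x) (by linarith) hcx1
  have b := (bE_deriv (c := 1) (x := x) (by linarith) (by linarith)).const_mul lam
  have := a.sub b
  simp only [one_mul] at this
  refine this.congr_deriv ?_
  ring

lemma gerber_x {c x0 : ℝ} (hc0 : 0 ≤ c) (hc1 : c ≤ 1) (h0 : 0 ≤ x0) (h1 : x0 ≤ 1) :
    ∃ lam : ℝ, ∀ x ∈ Set.Icc (0:ℝ) 1,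
      Real.binEntropy ((1 - c * x0) / 2) - lam * Real.binEntropy ((1 - x0) / 2)
      ≤ Real.binEntropy ((1 - c * x) / 2) - lam * Real.binEntropy ((1 - x) / 2) := by
  have key : ∀ lam : ℝ, (∀ x, 0 < x → x < x0 → lam * AA x ≤ c * AA (c * x)) →
      (∀ x, x0 < x → x < 1 → c * AA (c * x) ≤ lam * AA x) → ∃ lam : ℝ, ∀ x ∈ Set.Icc (0:ℝ) 1,
      Real.binEntropy ((1 - c * x0) / 2) - lam * Real.binEntropy ((1 - x0) / 2)
      ≤ Real.binEntropy ((1 - c * x) / 2) - lam * Real.binEntropy ((1 - x) / 2) := by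
    intro lam ha hb
    refine ⟨lam, ?_⟩
    intro x hx
    have hcont : Continuous (fun x => Real.binEntropy ((1 - c * x) / 2) - lam * Real.binEntropy ((1 - x) / 2)) := by
      fun_prop
    rcases le_total x x0 with h | h
    · have : AntitoneOn (fun x => Real.binEntropy ((1 - c * x) / 2) - lam * Real.binEntropy ((1 - x) / 2)) (Set.Icc 0 x0) := by
        apply antitoneOn_of_deriv_nonpos (convex_Icc 0 x0) hcont.continuousOn
        · intro t ht
          rw [interior_Icc] at ht
          exact (E_deriv hc0 hc1 ht.1 (by linarith [ht.2])).differentiableAt.differentiableWithinAt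
        · intro t ht
          rw [interior_Icc] at ht
          rw [(E_deriv hc0 hc1 ht.1 (by linarith [ht.2])).deriv]
          linarith [ha t ht.1 ht.2]
      exact this ⟨hx.1, h⟩ ⟨h0, le_refl _⟩ h
    · have : MonotoneOn (fun x => Real.binEntropy ((1 - c * x) / 2) - lam * Real.binEntropy ((1 - x) / 2)) (Set.Icc x0 1) := by
        apply monotoneOn_of_deriv_nonneg (convex_Icc x0 1) hcont.continuousOn
        · intro t ht
          rw [interior_Icc] at ht
          exact (E_deriv hc0 hc1 (by linarith [ht.1]) (by linarith [ht.2])).differentiableAt.differentiableWithinAt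
        · intro t ht
          rw [interior_Icc] at ht
          rw [(E_deriv hc0 hc1 (by linarith [ht.1]) (by linarith [ht.2])).deriv]
          linarith [hb t ht.1 ht.2]
      exact this ⟨le_refl _, h1⟩ ⟨h, hx.2⟩ h
  rcases h0.eq_or_lt with h0 | h0
  · subst h0
    apply key (c * c)
    · intro x hx hx'
      exact absurd hx (not_lt.2 hx'.le)
    · intro x hx hx'
      have := AA_smul hc0 hc1 hx.le hx'
      nlinarith
  rcases h1.eq_or_lt with h1 | h1
  · subst h1
    apply key 0
    · intro x hx hx'
      have hcx0 : 0 ≤ c * x := mul_nonneg hc0 hx.le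
      have hcx1 : c * x < 1 := by nlinarith
      have := AA_nonneg hcx0 hcx1
      rw [zero_mul]; positivity
    · intro x hx hx'
      exact absurd hx (not_lt.2 hx'.le)
  apply key (c * (AA (c * x0) / AA x0))
  · intro x hx hx'
    have hx1 : x < 1 := hx'.trans h1
    have := ratio_anti hc0 hc1 ⟨hx, hx1⟩ ⟨h0, h1⟩ hx'.le
    simp only at this
    have hp := AA_pos hx hx1
    rw [mul_assoc]
    apply mul_le_mul_of_nonneg_left _ hc0
    rwa [← le_div_iff₀ hp]
  · intro x hx hx'
    have := ratio_anti hc0 hc1 ⟨h0, h1⟩ ⟨h0.trans hx, hx'⟩ hx.le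
    simp only at this
    have hp := AA_pos (h0.trans hx) hx'
    rw [mul_assoc]
    apply mul_le_mul_of_nonneg_left _ hc0
    rwa [← div_le_iff₀ hp]

lemma gerber_scalar {q a : ℝ} (hq0 : 0 ≤ q) (hq1 : q ≤ 1 / 2) (ha0 : 0 ≤ a) (ha1 : a ≤ 1 / 2) :
    ∃ lam : ℝ, ∀ b ∈ Set.Icc (0:ℝ) 1,
      Real.binEntropy (bconv a q) - lam * Real.binEntropy a
      ≤ Real.binEntropy (bconv b q) - lam * Real.binEntropy b := by
  obtain ⟨lam, h⟩ := gerber_x (c := 1 - 2 * q) (x0 := 1 - 2 * a) (by linarith) (by linarith)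
    (by linarith) (by linarith)
  have e : ∀ b, (1 - (1 - 2 * q) * (1 - 2 * b)) / 2 = bconv b q := by
    intro b; unfold bconv; ring
  have e' : ∀ b : ℝ, (1 - (1 - 2 * b)) / 2 = b := by intro b; ring
  have h2 : ∀ b ∈ Set.Icc (0:ℝ) (1/2), Real.binEntropy (bconv a q) - lam * Real.binEntropy a
      ≤ Real.binEntropy (bconv b q) - lam * Real.binEntropy b := by
    intro b hb
    have := h (1 - 2 * b) ⟨by linarith [hb.2], by linarith [hb.1]⟩
    rwa [e, e', e, e'] at this
  refine ⟨lam, ?_⟩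
  intro b hb
  rcases le_total b (1/2) with h3 | h3
  · exact h2 b ⟨hb.1, h3⟩
  · have := h2 (1 - b) ⟨by linarith [hb.2], by linarith⟩
    have e3 : bconv (1 - b) q = 1 - bconv b q := by unfold bconv; ring
    rwa [e3, Real.binEntropy_one_sub, Real.binEntropy_one_sub] at this

/-! ### Part B: entropy tools -/

/-- Entropy in nats. -/
def Ent {α : Type} [Fintype α] (P : α → ℝ) : ℝ := ∑ a, Real.negMulLog (P a)

/-- Memoryless extension of the binary symmetric channel. -/
def bk (p : ℝ) (n : ℕ) (x y : Fin n → Bool) : ℝ := ∏ t, BSCk p (x t) (y t)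

lemma BSCk_nonneg {p : ℝ} (h0 : 0 ≤ p) (h1 : p ≤ 1) (x y : Bool) : 0 ≤ BSCk p x y := by
  unfold BSCk; split_ifs <;> linarith

lemma bk_nonneg {p : ℝ} (h0 : 0 ≤ p) (h1 : p ≤ 1) {n : ℕ} (x y : Fin n → Bool) : 0 ≤ bk p n x y :=
  prod_nonneg fun _ _ => BSCk_nonneg h0 h1 _ _

lemma sum_prod_fun {n : ℕ} {α : Type} [Fintype α] (F : Fin n → α → ℝ) :
    ∑ x : Fin n → α, ∏ t, F t (x t) = ∏ t, ∑ a, F t a := by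
  rw [Finset.prod_univ_sum]; simp

lemma sumBoolCons {n : ℕ} {α : Type} [Fintype α] (F : (Fin (n+1) → α) → ℝ) :
    ∑ x, F x = ∑ a, ∑ x : Fin n → α, F (Fin.cons a x) := by
  rw [← Fintype.sum_prod_type' (f := fun a (x : Fin n → α) => F (Fin.cons a x))]
  exact (Fintype.sum_equiv (Fin.consEquiv (fun _ => α)) _ _ (fun x => rfl)).symm

lemma bk_sum (p : ℝ) {n : ℕ} (x : Fin n → Bool) : ∑ y, bk p n x y = 1 := by
  unfold bk
  rw [sum_prod_fun (fun t a => BSCk p (x t) a)]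
  apply prod_eq_one
  intro t _
  cases x t <;> simp [BSCk]

lemma BSCk_symm (p : ℝ) (x y : Bool) : BSCk p x y = BSCk p y x := by
  unfold BSCk; simp [eq_comm]

lemma bk_symm (p : ℝ) {n : ℕ} (x y : Fin n → Bool) : bk p n x y = bk p n y x := by
  unfold bk; exact prod_congr rfl fun t _ => BSCk_symm _ _ _

lemma BSCk_comp (p q : ℝ) (x y : Bool) :
    ∑ z, BSCk p x z * BSCk q z y = BSCk (bconv p q) x y := by
  cases x <;> cases y <;> simp [BSCk, bconv] <;> ring

lemma bk_comp (p q : ℝ) {n : ℕ} (x y : Fin n → Bool) :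
    ∑ z, bk p n x z * bk q n z y = bk (bconv p q) n x y := by
  unfold bk
  simp_rw [← prod_mul_distrib]
  rw [sum_prod_fun (fun t z => BSCk p (x t) z * BSCk q z (y t))]
  simp_rw [BSCk_comp]

lemma bk_cons (p : ℝ) {n : ℕ} (a b : Bool) (x y : Fin n → Bool) :
    bk p (n+1) (Fin.cons a x) (Fin.cons b y) = BSCk p a b * bk p n x y := by
  unfold bk
  rw [Fin.prod_univ_succ]; simp

lemma gibbs {p q : ℝ} (hp : 0 ≤ p) (hq : 0 ≤ q) (h : q = 0 → p = 0) :
    p * Real.log q + Real.negMulLog p ≤ q - p := by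
  rcases hp.eq_or_lt with h0 | h0
  · subst h0; simpa using hq
  have hq0 : 0 < q := lt_of_le_of_ne hq fun e => h0.ne' (h e.symm)
  have := Real.log_le_sub_one_of_pos (div_pos hq0 h0)
  rw [Real.log_div hq0.ne' h0.ne'] at this
  have := mul_le_mul_of_nonneg_left this hp
  rw [mul_sub, mul_sub, mul_div_cancel₀ _ h0.ne'] at this
  unfold Real.negMulLog
  linarith

/-- Homogeneous two-point entropy. -/
def F2 (u v : ℝ) : ℝ := Real.negMulLog u + Real.negMulLog v - Real.negMulLog (u + v)

lemma F2_le {u v r s : ℝ} (hu : 0 ≤ u) (hv : 0 ≤ v) (hr : 0 < r) (hs : 0 < s) (hrs : r + s = 1) :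
    F2 u v ≤ -(u * Real.log r) - v * Real.log s := by
  rcases (add_nonneg hu hv).eq_or_lt with h | h
  · have h1 : u = 0 := by linarith
    have h2 : v = 0 := by linarith
    simp [h1, h2, F2]
  have g1 := gibbs hu (mul_nonneg hr.le h.le) (fun e => absurd e (mul_pos hr h).ne')
  have g2 := gibbs hv (mul_nonneg hs.le h.le) (fun e => absurd e (mul_pos hs h).ne')
  rw [Real.log_mul hr.ne' h.ne'] at g1
  rw [Real.log_mul hs.ne' h.ne'] at g2
  have e : r * (u + v) + s * (u + v) = u + v := by rw [← add_mul, hrs, one_mul]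
  unfold F2
  have e2 : Real.negMulLog (u + v) = -(u + v) * Real.log (u + v) := rfl
  rw [e2]
  linarith

lemma F2_eq {u v : ℝ} (hu : 0 < u) (hv : 0 < v) :
    F2 u v = -(u * Real.log (u / (u + v))) - v * Real.log (v / (u + v)) := by
  rw [Real.log_div hu.ne' (by positivity), Real.log_div hv.ne' (by positivity)]
  unfold F2 Real.negMulLog
  ring

lemma F2_super {ι : Type} [Fintype ι] (t u v : ι → ℝ) (ht : ∀ i, 0 ≤ t i) (hu : ∀ i, 0 ≤ u i)
    (hv : ∀ i, 0 ≤ v i) :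
    ∑ i, t i * F2 (u i) (v i) ≤ F2 (∑ i, t i * u i) (∑ i, t i * v i) := by
  have hU : 0 ≤ ∑ i, t i * u i := sum_nonneg fun i _ => mul_nonneg (ht i) (hu i)
  have hV : 0 ≤ ∑ i, t i * v i := sum_nonneg fun i _ => mul_nonneg (ht i) (hv i)
  rcases hU.eq_or_lt with h | hU
  · have h1 := (sum_eq_zero_iff_of_nonneg (fun i _ => mul_nonneg (ht i) (hu i))).1 h.symm
    rw [← h, sum_eq_zero]
    · simp [F2]
    · intro i hi
      rcases mul_eq_zero.1 (h1 i hi) with e | e <;> simp [e, F2]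
  rcases hV.eq_or_lt with h | hV
  · have h1 := (sum_eq_zero_iff_of_nonneg (fun i _ => mul_nonneg (ht i) (hv i))).1 h.symm
    rw [← h, sum_eq_zero]
    · simp [F2]
    · intro i hi
      rcases mul_eq_zero.1 (h1 i hi) with e | e <;> simp [e, F2]
  rw [F2_eq hU hV]
  set U := ∑ i, t i * u i with hUd
  set V := ∑ i, t i * v i with hVd
  have h1 : ∀ i, t i * F2 (u i) (v i) ≤
      -(t i * u i * Real.log (U / (U + V))) - t i * v i * Real.log (V / (U + V)) := by
    intro i
    have := mul_le_mul_of_nonneg_left (F2_le (hu i) (hv i) (r := U / (U + V)) (s := V / (U + V))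
      (by positivity) (by positivity) (by field_simp)) (ht i)
    linarith
  refine (sum_le_sum fun i _ => h1 i).trans (le_of_eq ?_)
  rw [sum_sub_distrib, sum_neg_distrib, ← sum_mul, ← sum_mul]

lemma F2_hom {s b : ℝ} : F2 (s * b) (s * (1 - b)) = s * Real.binEntropy b := by
  unfold F2
  rw [Real.binEntropy_eq_negMulLog_add_negMulLog_one_sub, show s * b + s * (1 - b) = s by ring,
    Real.negMulLog_mul, Real.negMulLog_mul]
  ring

lemma F2_gerber {q lam c : ℝ}
    (hc : ∀ b ∈ Set.Icc (0:ℝ) 1, c ≤ Real.binEntropy (bconv b q) - lam * Real.binEntropy b)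
    {u v : ℝ} (hu : 0 ≤ u) (hv : 0 ≤ v) :
    c * (u + v) ≤ F2 ((1 - q) * u + q * v) (q * u + (1 - q) * v) - lam * F2 u v := by
  rcases (add_nonneg hu hv).eq_or_lt with h | h
  · have h1 : u = 0 := by linarith
    have h2 : v = 0 := by linarith
    simp [h1, h2, F2]
  obtain ⟨s, hs⟩ : ∃ s, s = u + v := ⟨_, rfl⟩
  obtain ⟨b, hb⟩ : ∃ b, b = u / s := ⟨_, rfl⟩
  rw [← hs] at h
  have hu' : u = s * b := by rw [hb]; field_simp
  have hv' : v = s * (1 - b) := by rw [mul_sub, ← hu']; linarith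
  have hb0 : 0 ≤ b := by rw [hb]; positivity
  have hb1 : b ≤ 1 := by rw [hb, div_le_one h]; linarith
  have e1 : (1 - q) * u + q * v = s * bconv b q := by rw [hu', hv']; unfold bconv; ring
  have e2 : q * u + (1 - q) * v = s * (1 - bconv b q) := by rw [hu', hv']; unfold bconv; ring
  rw [e1, e2, ← hs, hu', hv', F2_hom, F2_hom]
  have := mul_le_mul_of_nonneg_left (hc b ⟨hb0, hb1⟩) h.le
  linarith

lemma Ent_cons {n : ℕ} (P : (Fin (n+1) → Bool) → ℝ) :
    Ent P = Ent (fun z : Fin n → Bool => P (Fin.cons true z) + P (Fin.cons false z))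
      + ∑ z : Fin n → Bool, F2 (P (Fin.cons true z)) (P (Fin.cons false z)) := by
  unfold Ent F2
  rw [sumBoolCons, ← sum_add_distrib]
  simp only [Fintype.sum_bool]
  rw [← sum_add_distrib]
  apply sum_congr rfl
  intro z _
  ring

/-- Vector Gerber inequality, Lagrangian form. -/
lemma gerber_vec {q lam c : ℝ} (hq0 : 0 ≤ q) (hq1 : q ≤ 1)
    (hc : ∀ b ∈ Set.Icc (0:ℝ) 1, c ≤ Real.binEntropy (bconv b q) - lam * Real.binEntropy b) :
    ∀ (n : ℕ) (P : (Fin n → Bool) → ℝ), (∀ z, 0 ≤ P z) → ∑ z, P z = 1 →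
      n * c ≤ Ent (fun y => ∑ z, P z * bk q n z y) - lam * Ent P := by
  intro n
  induction n with
  | zero =>
    intro P hP h1
    rw [Fintype.sum_unique] at h1
    unfold Ent
    rw [Fintype.sum_unique, Fintype.sum_unique]
    beta_reduce
    rw [Fintype.sum_unique, h1]
    simp [bk]
  | succ n ih =>
    intro P hP h1
    have hr1 : ∑ z : Fin n → Bool, (P (Fin.cons true z) + P (Fin.cons false z)) = 1 := by
      rw [sumBoolCons] at h1
      simpa [sum_add_distrib] using h1
    have hI := ih (fun z => P (Fin.cons true z) + P (Fin.cons false z))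
      (fun z => add_nonneg (hP _) (hP _)) hr1
    rw [Ent_cons, Ent_cons P]
    have eT : ∀ y : Fin n → Bool, ∑ z, P z * bk q (n+1) z (Fin.cons true y) =
        ∑ z : Fin n → Bool, bk q n z y * ((1 - q) * P (Fin.cons true z) + q * P (Fin.cons false z)) := by
      intro y
      rw [sumBoolCons]
      simp only [Fintype.sum_bool, bk_cons]
      rw [← sum_add_distrib]
      apply sum_congr rfl
      intro z _
      simp [BSCk]; ring
    have eF : ∀ y : Fin n → Bool, ∑ z, P z * bk q (n+1) z (Fin.cons false y) =
        ∑ z : Fin n → Bool, bk q n z y * (q * P (Fin.cons true z) + (1 - q) * P (Fin.cons false z)) := by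
      intro y
      rw [sumBoolCons]
      simp only [Fintype.sum_bool, bk_cons]
      rw [← sum_add_distrib]
      apply sum_congr rfl
      intro z _
      simp [BSCk]; ring
    have eS : ∀ y : Fin n → Bool, ∑ z, P z * bk q (n+1) z (Fin.cons true y) +
        ∑ z, P z * bk q (n+1) z (Fin.cons false y)
        = ∑ z : Fin n → Bool, (P (Fin.cons true z) + P (Fin.cons false z)) * bk q n z y := by
      intro y
      rw [eT, eF, ← sum_add_distrib]
      apply sum_congr rfl
      intro z _
      ring
    simp only [eS]
    have hsup : ∑ z : Fin n → Bool, F2 ((1 - q) * P (Fin.cons true z) + q * P (Fin.cons false z))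
          (q * P (Fin.cons true z) + (1 - q) * P (Fin.cons false z)) ≤
        ∑ y : Fin n → Bool, F2 (∑ z, P z * bk q (n+1) z (Fin.cons true y))
          (∑ z, P z * bk q (n+1) z (Fin.cons false y)) := by
      have hq' : 0 ≤ 1 - q := by linarith
      have : ∀ y : Fin n → Bool, _ := fun y => F2_super (fun z => bk q n z y)
        (fun z => (1 - q) * P (Fin.cons true z) + q * P (Fin.cons false z))
        (fun z => q * P (Fin.cons true z) + (1 - q) * P (Fin.cons false z))
        (fun z => bk_nonneg hq0 hq1 _ _)
        (fun z => add_nonneg (mul_nonneg hq' (hP _)) (mul_nonneg hq0 (hP _)))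
        (fun z => add_nonneg (mul_nonneg hq0 (hP _)) (mul_nonneg hq' (hP _)))
      simp only [eT, eF]
      refine le_trans (le_of_eq ?_) (sum_le_sum fun y _ => this y)
      rw [sum_comm]
      apply sum_congr rfl
      intro z _
      rw [← sum_mul, bk_sum, one_mul]
    have hpt : c ≤ ∑ z : Fin n → Bool, F2 ((1 - q) * P (Fin.cons true z) + q * P (Fin.cons false z))
          (q * P (Fin.cons true z) + (1 - q) * P (Fin.cons false z))
        - lam * ∑ z : Fin n → Bool, F2 (P (Fin.cons true z)) (P (Fin.cons false z)) := by
      rw [mul_sum, ← sum_sub_distrib]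
      refine le_trans (le_of_eq ?_) (sum_le_sum fun z _ => F2_gerber hc (hP (Fin.cons true z)) (hP (Fin.cons false z)))
      rw [← mul_sum, hr1, mul_one]
    push_cast
    linarith

lemma Ent_le_log_card {α : Type} [Fintype α] (P : α → ℝ) (hP : ∀ a, 0 ≤ P a) (h1 : ∑ a, P a = 1) :
    Ent P ≤ Real.log (Fintype.card α) := by
  have hne : Nonempty α := by
    by_contra h
    rw [not_nonempty_iff] at h
    simp at h1
  have hc : (0:ℝ) < Fintype.card α := by exact_mod_cast Fintype.card_pos
  have := sum_le_sum fun a (_ : a ∈ (univ : Finset α)) =>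
    gibbs (hP a) (q := 1 / Fintype.card α) (by positivity) (fun e => absurd e (by positivity))
  rw [sum_add_distrib, ← sum_mul, h1, sum_sub_distrib, h1] at this
  simp only [one_div, Real.log_inv, sum_const, card_univ, nsmul_eq_mul] at this
  rw [mul_inv_cancel₀ hc.ne'] at this
  unfold Ent
  linarith

lemma Ent_bool_le {n : ℕ} (P : (Fin n → Bool) → ℝ) (hP : ∀ a, 0 ≤ P a) (h1 : ∑ a, P a = 1) :
    Ent P ≤ n * Real.log 2 := by
  have := Ent_le_log_card P hP h1
  simpa using this

lemma Ent_bk (p : ℝ) : ∀ (n : ℕ) (x : Fin n → Bool), Ent (bk p n x) = n * Real.binEntropy p := by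
  intro n
  induction n with
  | zero => intro x; simp [Ent, bk]
  | succ n ih =>
    intro x
    have hx : x = Fin.cons (x 0) (Fin.tail x) := (Fin.cons_self_tail x).symm
    rw [hx]
    generalize x 0 = a
    generalize Fin.tail x = x'
    have := ih x'
    unfold Ent at this ⊢
    rw [sumBoolCons]
    simp only [bk_cons, Real.negMulLog_mul]
    simp only [sum_add_distrib, ← sum_mul, ← mul_sum, this, bk_sum, one_mul]
    have e : ∑ b, Real.negMulLog (BSCk p a b) = Real.binEntropy p := by
      rw [Real.binEntropy_eq_negMulLog_add_negMulLog_one_sub]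
      cases a <;> simp [BSCk, add_comm]
    have e' : ∑ b, BSCk p a b = 1 := by cases a <;> simp [BSCk]
    rw [e, e']; push_cast; ring

lemma Ent_concave {ι α : Type} [Fintype ι] [Fintype α] [Nonempty ι] (V : ι → α → ℝ)
    (hV : ∀ i a, 0 ≤ V i a) :
    (∑ i, Ent (V i)) / Fintype.card ι ≤ Ent (fun a => (∑ i, V i a) / Fintype.card ι) := by
  have hc : (0:ℝ) < Fintype.card ι := by exact_mod_cast Fintype.card_pos
  unfold Ent
  rw [sum_comm, sum_div]
  apply sum_le_sum
  intro a _
  have := Real.concaveOn_negMulLog.le_map_sum (t := (univ : Finset ι)) (w := fun _ => 1 / (Fintype.card ι : ℝ))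
    (p := fun i => V i a) (fun i _ => by positivity) (by simp [hc.ne']) (fun i _ => hV i a)
  simp only [smul_eq_mul, ← mul_sum] at this
  simp only [div_eq_inv_mul]
  rw [one_div] at this
  exact this

/-- Linearised Fano inequality. -/
lemma fano {M Y : Type} [Fintype M] [DecidableEq M] [Fintype Y] [Nonempty M] (V : M → Y → ℝ)
    (hV : ∀ m y, 0 ≤ V m y) (hV1 : ∀ m, ∑ y, V m y = 1) (g : Y → M) {d : ℝ} (hd0 : 0 < d) (hd1 : d < 1) :
    Real.log (Fintype.card M) + (∑ m, Ent (V m)) / Fintype.card M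
      - Ent (fun y => (∑ m, V m y) / Fintype.card M)
    ≤ -Real.log (1 - d) + ((∑ m, ∑ y, V m y * (if g y = m then 0 else 1)) / Fintype.card M) *
        (Real.log (Fintype.card M) - Real.log d) := by
  obtain ⟨k, hk⟩ : ∃ k : ℝ, k = (Fintype.card M : ℝ) := ⟨_, rfl⟩
  have hk1 : 1 ≤ k := by rw [hk]; exact_mod_cast Fintype.card_pos (α := M)
  have hk0 : 0 < k := by linarith
  rw [← hk]
  set S : Y → ℝ := fun y => ∑ m, V m y with hS
  have hS0 : ∀ y, 0 ≤ S y := fun y => sum_nonneg fun m _ => hV m y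
  have hSS : ∑ y, S y = k := by
    rw [hS]; simp only; rw [sum_comm]; simp [hV1, hk]
  set Q : M → Y → ℝ := fun m y => if g y = m then 1 - d else d / k with hQ
  have hQ0 : ∀ m y, 0 < Q m y := by
    intro m y; simp only [hQ]; split_ifs
    · linarith
    · positivity
  have hQs : ∀ y, ∑ m, Q m y ≤ 1 := by
    intro y
    have : ∀ m, Q m y ≤ (if g y = m then 1 - d else 0) + d / k := by
      intro m; simp only [hQ]
      have : 0 < d / k := by positivity
      split_ifs <;> linarith
    refine (sum_le_sum fun m _ => this m).trans ?_
    rw [sum_add_distrib]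
    simp only [sum_ite_eq, mem_univ, if_true, sum_const, card_univ, nsmul_eq_mul, ← hk]
    rw [mul_div_cancel₀ _ hk0.ne']; linarith
  have hpt : ∀ y m, V m y * Real.log (S y) + V m y * Real.log (Q m y) + Real.negMulLog (V m y)
      ≤ S y * Q m y - V m y := by
    intro y m
    rcases (hS0 y).eq_or_lt with h | h
    · have : V m y = 0 := by
        have := (sum_eq_zero_iff_of_nonneg (fun m _ => hV m y)).1 h.symm
        exact this m (mem_univ _)
      simp [this, ← h]
    · have := gibbs (hV m y) (mul_nonneg h.le (hQ0 m y).le) (fun e => absurd e (mul_pos h (hQ0 m y)).ne')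
      rw [Real.log_mul h.ne' (hQ0 m y).ne'] at this
      linarith
  have hsum := sum_le_sum fun y (_ : y ∈ (univ : Finset Y)) => sum_le_sum fun m (_ : m ∈ (univ : Finset M)) => hpt y m
  simp only [sum_add_distrib, sum_sub_distrib] at hsum
  have r1 : ∑ y, ∑ m, S y * Q m y ≤ k := by
    rw [← hSS]
    apply sum_le_sum
    intro y _
    rw [← mul_sum]
    exact mul_le_of_le_one_right (hS0 y) (hQs y)
  have r2 : ∑ y, ∑ m, V m y = k := hSS
  have l1 : ∑ y, ∑ m, V m y * Real.log (S y) = k * Real.log k - k * Ent (fun y => S y / k) := by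
    have : ∀ y, ∑ m, V m y * Real.log (S y) = S y * Real.log k - k * Real.negMulLog (S y / k) := by
      intro y
      rw [← sum_mul]
      change S y * _ = _
      rcases (hS0 y).eq_or_lt with h | h
      · simp [← h]
      · unfold Real.negMulLog
        rw [Real.log_div h.ne' hk0.ne']
        field_simp
        ring
    simp only [this, sum_sub_distrib, ← sum_mul, ← mul_sum, hSS]
    rfl
  have l3 : ∑ y, ∑ m, Real.negMulLog (V m y) = ∑ m, Ent (V m) := by
    rw [sum_comm]; rfl
  set er : ℝ := ∑ m, ∑ y, V m y * (if g y = m then 0 else 1) with her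
  have l2 : -(∑ y, ∑ m, V m y * Real.log (Q m y)) ≤ k * -Real.log (1 - d) + er * (Real.log k - Real.log d) := by
    rw [show k * -Real.log (1 - d) = (∑ y, S y) * -Real.log (1 - d) by rw [hSS], her, sum_comm (s := (univ : Finset M))]
    simp only [hS, sum_mul]
    rw [← sum_neg_distrib, ← sum_add_distrib]
    apply sum_le_sum
    intro y _
    rw [← sum_neg_distrib, ← sum_add_distrib]
    apply sum_le_sum
    intro m _
    have hlog : Real.log (1 - d) ≤ 0 := Real.log_nonpos (by linarith) (by linarith)
    simp only [hQ]
    split_ifs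
    · simp
    · rw [Real.log_div hd0.ne' hk0.ne']
      have := mul_nonneg (hV m y) (neg_nonneg.2 hlog)
      linarith
  rw [l1, l3, r2] at hsum
  have : k * (Real.log k + (∑ m, Ent (V m)) / k - Ent (fun y => S y / k)) ≤
      k * (-Real.log (1 - d) + er / k * (Real.log k - Real.log d)) := by
    have e1 : k * (Real.log k + (∑ m, Ent (V m)) / k - Ent (fun y => S y / k)) =
      k * Real.log k + (∑ m, Ent (V m)) - k * Ent (fun y => S y / k) := by
      field_simp
    have e2 : k * (-Real.log (1 - d) + er / k * (Real.log k - Real.log d)) =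
      k * -Real.log (1 - d) + er * (Real.log k - Real.log d) := by
      field_simp
    rw [e1, e2]
    linarith
  exact le_of_mul_le_mul_left this hk0

/-! ### Part C: converse -/

lemma Hb_eq (x : ℝ) : Hb x = Real.binEntropy x / Real.log 2 := by
  unfold Hb Real.binEntropy Real.logb
  rw [Real.log_inv, Real.log_inv]
  ring

lemma nFold_marg1 {p : ℝ} {W : Bool → Bool × Bool → ℝ} (hm : ∀ x y, margW1 W x y = BSCk p x y)
    {n : ℕ} (x y1 : Fin n → Bool) : ∑ y2, nFold W n x (y1, y2) = bk p n x y1 := by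
  unfold nFold bk
  rw [sum_prod_fun (fun t a => W (x t) (y1 t, a))]
  exact prod_congr rfl fun t _ => hm _ _

lemma nFold_marg2 {p : ℝ} {W : Bool → Bool × Bool → ℝ} (hm : ∀ x y, margW2 W x y = BSCk p x y)
    {n : ℕ} (x y2 : Fin n → Bool) : ∑ y1, nFold W n x (y1, y2) = bk p n x y2 := by
  unfold nFold bk
  rw [sum_prod_fun (fun t a => W (x t) (a, y2 t))]
  exact prod_congr rfl fun t _ => hm _ _

lemma nFold_nonneg {W : Bool → Bool × Bool → ℝ} (hW : IsChannel W) {n : ℕ} (x : Fin n → Bool)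
    (y : (Fin n → Bool) × (Fin n → Bool)) : 0 ≤ nFold W n x y :=
  prod_nonneg fun _ _ => (hW _).1 _

lemma sum_marg1 {p : ℝ} {W : Bool → Bool × Bool → ℝ} (hm : ∀ x y, margW1 W x y = BSCk p x y)
    {n : ℕ} (x : Fin n → Bool) (φ : (Fin n → Bool) → ℝ) :
    ∑ y : (Fin n → Bool) × (Fin n → Bool), nFold W n x y * φ y.1 = ∑ y, bk p n x y * φ y := by
  rw [Fintype.sum_prod_type]
  apply sum_congr rfl
  intro y _
  simp only [← sum_mul]
  rw [nFold_marg1 hm]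

lemma sum_marg2 {p : ℝ} {W : Bool → Bool × Bool → ℝ} (hm : ∀ x y, margW2 W x y = BSCk p x y)
    {n : ℕ} (x : Fin n → Bool) (φ : (Fin n → Bool) → ℝ) :
    ∑ y : (Fin n → Bool) × (Fin n → Bool), nFold W n x y * φ y.2 = ∑ y, bk p n x y * φ y := by
  rw [Fintype.sum_prod_type, sum_comm]
  apply sum_congr rfl
  intro y _
  simp only [← sum_mul]
  rw [nFold_marg2 hm]

lemma err_ge {W : Bool → Bool × Bool → ℝ} (hW : IsChannel W) {n : ℕ} (x : Fin n → Bool)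
    (A B : (Fin n → Bool) × (Fin n → Bool) → Prop) [DecidablePred A] [DecidablePred B] :
    ∑ y, nFold W n x y * (if A y then 0 else 1) ≤
      ∑ y, nFold W n x y * (if A y ∧ B y then 0 else 1) := by
  apply sum_le_sum
  intro y _
  apply mul_le_mul_of_nonneg_left _ (nFold_nonneg hW x y)
  by_cases a : A y <;> by_cases b : B y <;> simp [a, b]

lemma err_ge' {W : Bool → Bool × Bool → ℝ} (hW : IsChannel W) {n : ℕ} (x : Fin n → Bool)
    (A B : (Fin n → Bool) × (Fin n → Bool) → Prop) [DecidablePred A] [DecidablePred B] :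
    ∑ y, nFold W n x y * (if B y then 0 else 1) ≤
      ∑ y, nFold W n x y * (if A y ∧ B y then 0 else 1) := by
  apply sum_le_sum
  intro y _
  apply mul_le_mul_of_nonneg_left _ (nFold_nonneg hW x y)
  by_cases a : A y <;> by_cases b : B y <;> simp [a, b]

lemma err_le {W : Bool → Bool × Bool → ℝ} (hW : IsChannel W) {n : ℕ} (x : Fin n → Bool)
    (A B : (Fin n → Bool) × (Fin n → Bool) → Prop) [DecidablePred A] [DecidablePred B] :
    ∑ y, nFold W n x y * (if A y ∧ B y then 0 else 1) ≤
    ∑ y, nFold W n x y * (if A y then 0 else 1) + ∑ y, nFold W n x y * (if B y then 0 else 1) := by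
  rw [← sum_add_distrib]
  apply sum_le_sum
  intro y _
  rw [← mul_add]
  apply mul_le_mul_of_nonneg_left _ (nFold_nonneg hW x y)
  by_cases a : A y <;> by_cases b : B y <;> simp [a, b]

lemma bconv_half (p : ℝ) : bconv (1/2) p = 1/2 := by unfold bconv; ring
lemma bconv_zero (p : ℝ) : bconv 0 p = p := by unfold bconv; ring
lemma bconv_assoc (a b c : ℝ) : bconv a (bconv b c) = bconv (bconv a b) c := by unfold bconv; ring
lemma bconv_nonneg {a b : ℝ} (ha0 : 0 ≤ a) (ha : a ≤ 1/2) (hb0 : 0 ≤ b) (hb : b ≤ 1/2) :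
    0 ≤ bconv a b := by unfold bconv; nlinarith
lemma bconv_le {a b : ℝ} (ha : a ≤ 1/2) (hb : b ≤ 1/2) :
    bconv a b ≤ 1/2 := by unfold bconv; nlinarith

lemma exists_deg {p1 p2 : ℝ} (hp12 : p1 ≤ p2) (hp2 : p2 ≤ 1/2) :
    ∃ q, 0 ≤ q ∧ q ≤ 1/2 ∧ bconv p1 q = p2 := by
  rcases (hp12.trans hp2).eq_or_lt with h | h
  · refine ⟨0, le_refl _, by norm_num, ?_⟩
    unfold bconv; linarith
  · have h' : 0 < 1 - 2 * p1 := by linarith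
    refine ⟨(p2 - p1) / (1 - 2 * p1), div_nonneg (by linarith) h'.le, ?_, ?_⟩
    · rw [div_le_iff₀ h']; linarith
    · have := div_mul_cancel₀ (p2 - p1) h'.ne'
      unfold bconv; linarith

/-- Slack of the converse. -/
def etaS (e : ℝ) : ℝ := -Real.log (1 - e) - e * Real.log e

lemma etaS_tendsto : Filter.Tendsto etaS (nhdsWithin 0 (Set.Ioi 0)) (nhds 0) := by
  have hc : ContinuousAt etaS 0 := by
    have h1 : ContinuousAt (fun e : ℝ => -Real.log (1 - e)) 0 := by
      apply ContinuousAt.neg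
      apply ContinuousAt.log (by fun_prop) (by norm_num)
    exact h1.sub Real.continuous_mul_log.continuousAt
  have : etaS 0 = 0 := by simp [etaS]
  have h := hc.tendsto
  rw [this] at h
  exact h.mono_left nhdsWithin_le_nhds

lemma etaS_nonneg {e : ℝ} (h0 : 0 < e) (h1 : e < 1) : 0 ≤ etaS e := by
  unfold etaS
  have a : Real.log (1 - e) ≤ 0 := Real.log_nonpos (by linarith) (by linarith)
  have b : Real.log e ≤ 0 := Real.log_nonpos (by linarith) (by linarith)
  nlinarith

/-- Fano with error at most `e`. -/
lemma fano_e {M Y : Type} [Fintype M] [DecidableEq M] [Fintype Y] [Nonempty M] (V : M → Y → ℝ)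
    (hV : ∀ m y, 0 ≤ V m y) (hV1 : ∀ m, ∑ y, V m y = 1) (g : Y → M) {d e : ℝ} (hd0 : 0 < d) (hd1 : d < 1)
    (he : (∑ m, ∑ y, V m y * (if g y = m then 0 else 1)) / Fintype.card M ≤ e) :
    (1 - e) * Real.log (Fintype.card M) ≤ Ent (fun y => (∑ m, V m y) / Fintype.card M)
      - (∑ m, Ent (V m)) / Fintype.card M - Real.log (1 - d) - e * Real.log d := by
  have h := fano V hV hV1 g hd0 hd1
  have hk1 : (1:ℝ) ≤ Fintype.card M := by exact_mod_cast Fintype.card_pos (α := M)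
  have a : 0 ≤ Real.log (Fintype.card M) := Real.log_nonneg hk1
  have b : Real.log d ≤ 0 := Real.log_nonpos (by linarith) (by linarith)
  have := mul_le_mul_of_nonneg_right he (show 0 ≤ Real.log (Fintype.card M) - Real.log d by linarith)
  linarith

/-- Uniform mixture of codeword outputs. -/
def mixo (p : ℝ) (n : ℕ) {k : ℕ} (x : Fin k → Fin n → Bool) (y : Fin n → Bool) : ℝ :=
  (∑ i, bk p n (x i) y) / k

lemma mixo_nonneg {p : ℝ} (h0 : 0 ≤ p) (h1 : p ≤ 1) {n k : ℕ} (x : Fin k → Fin n → Bool) (y) :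
    0 ≤ mixo p n x y :=
  div_nonneg (sum_nonneg fun _ _ => bk_nonneg h0 h1 _ _) (Nat.cast_nonneg _)

lemma mixo_sum (p : ℝ) {n k : ℕ} (hk : 0 < k) (x : Fin k → Fin n → Bool) :
    ∑ y, mixo p n x y = 1 := by
  unfold mixo
  rw [← sum_div, sum_comm]
  have : (k:ℝ) ≠ 0 := by positivity
  simp [bk_sum, this]

lemma mixo_deg (p q : ℝ) {n k : ℕ} (x : Fin k → Fin n → Bool) (y) :
    ∑ z, mixo p n x z * bk q n z y = mixo (bconv p q) n x y := by
  unfold mixo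
  simp only [div_mul_eq_mul_div, sum_mul]
  rw [← sum_div, sum_comm]
  simp only [bk_comp]

lemma conv1_core {p1 p2 : ℝ} (hp1 : 0 ≤ p1) (hp12 : p1 ≤ p2) (hp2 : p2 ≤ 1/2)
    {n k1 k2 : ℕ} (hn : 0 < n) (hk1 : 0 < k1) (hk2 : 0 < k2) (f : Fin k1 × Fin k2 → Fin n → Bool)
    (g1 : (Fin n → Bool) × Fin k2 → Fin k1) (g2 : (Fin n → Bool) → Fin k2)
    {e : ℝ} (he0 : 0 < e) (he1 : e < 1)
    (h1 : (∑ m2, ∑ m1, ∑ y, bk p1 n (f (m1, m2)) y * (if g1 (y, m2) = m1 then 0 else 1)) / (k1 * k2) ≤ e)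
    (h2 : (∑ m2, ∑ m1, ∑ y, bk p2 n (f (m1, m2)) y * (if g2 y = m2 then 0 else 1)) / (k1 * k2) ≤ e) :
    ∃ α ∈ Set.Icc (0:ℝ) (1/2),
      (1 - e) * Real.log k1 ≤ n * (Real.binEntropy (bconv α p1) - Real.binEntropy p1) + etaS e ∧
      (1 - e) * Real.log k2 ≤ n * (Real.log 2 - Real.binEntropy (bconv α p2)) + etaS e := by
  have hk1' : (0:ℝ) < k1 := by exact_mod_cast hk1
  have hk2' : (0:ℝ) < k2 := by exact_mod_cast hk2
  have hn' : (0:ℝ) < n := by exact_mod_cast hn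
  haveI : Nonempty (Fin k1) := ⟨⟨0, hk1⟩⟩
  haveI : Nonempty (Fin k2) := ⟨⟨0, hk2⟩⟩
  have hp11 : p1 ≤ 1 := by linarith
  have hp20 : 0 ≤ p2 := by linarith
  have hp21 : p2 ≤ 1 := by linarith
  obtain ⟨q, hq0, hq1, hq⟩ := exists_deg hp12 hp2
  set P1 : Fin k2 → (Fin n → Bool) → ℝ := fun m2 => mixo p1 n (fun m1 => f (m1, m2)) with hP1
  set P2 : Fin k2 → (Fin n → Bool) → ℝ := fun m2 => mixo p2 n (fun m1 => f (m1, m2)) with hP2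
  set A1 : ℝ := (∑ m2, Ent (P1 m2)) / k2 with hA1
  set A2 : ℝ := (∑ m2, Ent (P2 m2)) / k2 with hA2
  -- choice of α
  have hlow : n * Real.binEntropy p1 ≤ A1 := by
    have : ∀ m2, n * Real.binEntropy p1 ≤ Ent (P1 m2) := by
      intro m2
      have := Ent_concave (fun m1 : Fin k1 => bk p1 n (f (m1, m2))) (fun _ _ => bk_nonneg hp1 hp11 _ _)
      simp only [Ent_bk, Fintype.card_fin, sum_const, card_univ, nsmul_eq_mul] at this
      rw [mul_div_cancel_left₀ _ hk1'.ne'] at this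
      exact this
    rw [hA1, le_div_iff₀ hk2']
    have := sum_le_sum fun m2 (_ : m2 ∈ (univ : Finset (Fin k2))) => this m2
    simp only [sum_const, card_univ, Fintype.card_fin, nsmul_eq_mul] at this
    linarith
  have hup : A1 ≤ n * Real.log 2 := by
    rw [hA1, div_le_iff₀ hk2']
    have := sum_le_sum fun m2 (_ : m2 ∈ (univ : Finset (Fin k2))) =>
      Ent_bool_le (P1 m2) (fun y => mixo_nonneg hp1 hp11 _ y) (mixo_sum p1 hk1 _)
    simp only [sum_const, card_univ, Fintype.card_fin, nsmul_eq_mul] at this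
    linarith
  obtain ⟨α, hα, hαe⟩ : ∃ α ∈ Set.Icc (0:ℝ) (1/2), Real.binEntropy (bconv α p1) = A1 / n := by
    have hcont : ContinuousOn (fun α => Real.binEntropy (bconv α p1)) (Set.Icc (0:ℝ) (1/2)) := by
      unfold bconv; fun_prop
    have := intermediate_value_Icc (by norm_num : (0:ℝ) ≤ 1/2) hcont
    have hmem : A1 / n ∈ Set.Icc (Real.binEntropy (bconv 0 p1)) (Real.binEntropy (bconv (1/2) p1)) := by
      rw [bconv_zero, bconv_half, one_div, Real.binEntropy_two_inv]
      constructor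
      · rw [le_div_iff₀ hn']; linarith
      · rw [div_le_iff₀ hn']; linarith
    obtain ⟨α, h, h'⟩ := this hmem
    exact ⟨α, h, h'⟩
  have hA1e : A1 = n * Real.binEntropy (bconv α p1) := by rw [hαe]; field_simp
  have hger : n * Real.binEntropy (bconv α p2) ≤ A2 := by
    obtain ⟨lam, hl⟩ := gerber_scalar hq0 hq1 (bconv_nonneg hα.1 hα.2 hp1 (hp12.trans hp2))
      (bconv_le hα.2 (hp12.trans hp2))
    rw [← bconv_assoc, hq] at hl
    have : ∀ m2, n * (Real.binEntropy (bconv α p2) - lam * Real.binEntropy (bconv α p1)) ≤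
        Ent (P2 m2) - lam * Ent (P1 m2) := by
      intro m2
      have := gerber_vec hq0 (by linarith) hl n (P1 m2) (fun y => mixo_nonneg hp1 hp11 _ y) (mixo_sum p1 hk1 _)
      simp only [hP1, mixo_deg, hq] at this
      exact this
    have := sum_le_sum fun m2 (_ : m2 ∈ (univ : Finset (Fin k2))) => this m2
    simp only [sum_const, card_univ, Fintype.card_fin, nsmul_eq_mul, sum_sub_distrib, ← mul_sum] at this
    have e1 : ∑ m2, Ent (P1 m2) = k2 * A1 := by rw [hA1]; field_simp
    have e2 : ∑ m2, Ent (P2 m2) = k2 * A2 := by rw [hA2]; field_simp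
    rw [e1, e2, hA1e] at this
    refine le_of_mul_le_mul_left ?_ hk2'
    linarith
  refine ⟨α, hα, ?_, ?_⟩
  · -- receiver 1
    have hf : ∀ m2, (1 - (∑ m1, ∑ y, bk p1 n (f (m1, m2)) y * (if g1 (y, m2) = m1 then 0 else 1)) / k1) * Real.log k1
        ≤ Ent (P1 m2) - n * Real.binEntropy p1 - Real.log (1 - e) -
        (∑ m1, ∑ y, bk p1 n (f (m1, m2)) y * (if g1 (y, m2) = m1 then 0 else 1)) / k1 * Real.log e := by
      intro m2
      have := fano_e (fun m1 : Fin k1 => bk p1 n (f (m1, m2))) (fun _ _ => bk_nonneg hp1 hp11 _ _)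
        (fun _ => bk_sum _ _) (fun y => g1 (y, m2)) he0 he1 (le_refl _)
      simp only [Ent_bk, Fintype.card_fin, sum_const, card_univ, nsmul_eq_mul] at this
      rw [mul_div_cancel_left₀ _ hk1'.ne'] at this
      exact this
    have hs := sum_le_sum fun m2 (_ : m2 ∈ (univ : Finset (Fin k2))) => hf m2
    simp only [sum_const, card_univ, Fintype.card_fin, nsmul_eq_mul, sum_sub_distrib, ← sum_mul, ← sum_div, mul_one] at hs
    set S := ∑ m2, ∑ m1, ∑ y, bk p1 n (f (m1, m2)) y * (if g1 (y, m2) = m1 then 0 else 1) with hS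
    have e1 : ∑ m2, Ent (P1 m2) = k2 * A1 := by rw [hA1]; field_simp
    have e2 : S / k1 = k2 * (S / (k1 * k2)) := by field_simp
    rw [e1, e2, hA1e] at hs
    have hs' : (1 - S / (k1 * k2)) * Real.log k1 ≤ n * Real.binEntropy (bconv α p1) - n * Real.binEntropy p1
        - Real.log (1 - e) - S / (k1 * k2) * Real.log e := by
      refine le_of_mul_le_mul_left ?_ hk2'
      linarith
    have a : 0 ≤ Real.log k1 := Real.log_nonneg (by exact_mod_cast hk1)
    have b : Real.log e ≤ 0 := Real.log_nonpos (by linarith) (by linarith)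
    have := mul_le_mul_of_nonneg_right h1 (show 0 ≤ Real.log k1 - Real.log e by linarith)
    unfold etaS
    linarith
  · have hf := fano_e P2 (fun _ y => mixo_nonneg hp20 hp21 _ y) (fun _ => mixo_sum p2 hk1 _) g2 he0 he1 (e := e) (by
      refine le_trans (le_of_eq ?_) h2
      rw [Fintype.card_fin, div_mul_eq_div_div]
      congr 1
      rw [sum_div]
      apply sum_congr rfl
      intro m2 _
      rw [sum_comm, sum_div]
      apply sum_congr rfl
      intro y _
      simp only [hP2, mixo, ← sum_mul]
      ring)
    rw [Fintype.card_fin] at hf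
    have hE : Ent (fun y => (∑ m, P2 m y) / (k2:ℝ)) ≤ n * Real.log 2 := by
      apply Ent_bool_le
      · intro y
        exact div_nonneg (sum_nonneg fun _ _ => mixo_nonneg hp20 hp21 _ y) hk2'.le
      · rw [← sum_div, sum_comm]
        have : ∀ m, ∑ y, P2 m y = 1 := fun m => mixo_sum p2 hk1 _
        simp [this, hk2'.ne']
    unfold etaS
    linarith

lemma Ent_joint {α β : Type} [Fintype α] [Fintype β] (P : α → ℝ) (K : α → β → ℝ) {h : ℝ}
    (hP : ∑ a, P a = 1) (hK : ∀ a, ∑ b, K a b = 1) (hh : ∀ a, Ent (K a) = h) :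
    Ent (fun x : α × β => P x.1 * K x.1 x.2) = Ent P + h := by
  unfold Ent at *
  rw [Fintype.sum_prod_type]
  simp only [Real.negMulLog_mul, sum_add_distrib, ← sum_mul, ← mul_sum, hK, hh, hP, one_mul]

lemma conv2_core {p1 p2 : ℝ} (hp1 : 0 ≤ p1) (hp12 : p1 ≤ p2) (hp2 : p2 ≤ 1/2)
    {n k1 k2 : ℕ} (hk1 : 0 < k1) (hk2 : 0 < k2) (f : Fin k1 × Fin k2 → Fin n → Bool)
    (g1 : (Fin n → Bool) → Fin k1) (g2 : (Fin n → Bool) × Fin k1 → Fin k2)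
    {e : ℝ} (he0 : 0 < e) (he1 : e < 1)
    (h1 : (∑ m1, ∑ m2, ∑ y, bk p1 n (f (m1, m2)) y * (if g1 y = m1 then 0 else 1)) / (k1 * k2) ≤ e / 2)
    (h2 : (∑ m1, ∑ m2, ∑ y, bk p2 n (f (m1, m2)) y * (if g2 (y, m1) = m2 then 0 else 1)) / (k1 * k2) ≤ e / 2) :
      (1 - e) * Real.log k2 ≤ n * (Real.log 2 - Real.binEntropy p2) + etaS e ∧
      (1 - e) * (Real.log k1 + Real.log k2) ≤ n * (Real.log 2 - Real.binEntropy p1) + etaS e := by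
  have hk1' : (0:ℝ) < k1 := by exact_mod_cast hk1
  have hk2' : (0:ℝ) < k2 := by exact_mod_cast hk2
  haveI : Nonempty (Fin k1) := ⟨⟨0, hk1⟩⟩
  haveI : Nonempty (Fin k2) := ⟨⟨0, hk2⟩⟩
  have hp11 : p1 ≤ 1 := by linarith
  have hp20 : 0 ≤ p2 := by linarith
  have hp21 : p2 ≤ 1 := by linarith
  obtain ⟨q, hq0, hq1, hq⟩ := exists_deg hp12 hp2
  constructor
  · have hf : ∀ m1, (1 - (∑ m2, ∑ y, bk p2 n (f (m1, m2)) y * (if g2 (y, m1) = m2 then 0 else 1)) / k2) * Real.log k2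
        ≤ n * Real.log 2 - n * Real.binEntropy p2 - Real.log (1 - e) -
        (∑ m2, ∑ y, bk p2 n (f (m1, m2)) y * (if g2 (y, m1) = m2 then 0 else 1)) / k2 * Real.log e := by
      intro m1
      have := fano_e (fun m2 : Fin k2 => bk p2 n (f (m1, m2))) (fun _ _ => bk_nonneg hp20 hp21 _ _)
        (fun _ => bk_sum _ _) (fun y => g2 (y, m1)) he0 he1 (le_refl _)
      simp only [Ent_bk, Fintype.card_fin, sum_const, card_univ, nsmul_eq_mul] at this
      rw [mul_div_cancel_left₀ _ hk2'.ne'] at this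
      have h3 := Ent_bool_le (mixo p2 n (fun m2 => f (m1, m2))) (fun y => mixo_nonneg hp20 hp21 _ y) (mixo_sum p2 hk2 _)
      refine this.trans ?_
      unfold mixo at h3
      linarith
    have hs := sum_le_sum fun m1 (_ : m1 ∈ (univ : Finset (Fin k1))) => hf m1
    simp only [sum_const, card_univ, Fintype.card_fin, nsmul_eq_mul, sum_sub_distrib, ← sum_mul, ← sum_div, mul_one] at hs
    set S := ∑ m1, ∑ m2, ∑ y, bk p2 n (f (m1, m2)) y * (if g2 (y, m1) = m2 then 0 else 1) with hS
    have e2 : S / k2 = k1 * (S / (k1 * k2)) := by field_simp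
    rw [e2] at hs
    have hs' : (1 - S / (k1 * k2)) * Real.log k2 ≤ n * Real.log 2 - n * Real.binEntropy p2
        - Real.log (1 - e) - S / (k1 * k2) * Real.log e := by
      refine le_of_mul_le_mul_left ?_ hk1'
      linarith
    have a : 0 ≤ Real.log k2 := Real.log_nonneg (by exact_mod_cast hk2)
    have b : Real.log e ≤ 0 := Real.log_nonpos (by linarith) (by linarith)
    have := mul_le_mul_of_nonneg_right (h2.trans (by linarith : e / 2 ≤ e)) (show 0 ≤ Real.log k2 - Real.log e by linarith)
    unfold etaS
    linarith
  · set V : Fin k1 × Fin k2 → (Fin n → Bool) × (Fin n → Bool) → ℝ :=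
      fun m y => bk p1 n (f m) y.1 * bk q n y.1 y.2 with hV
    have hV0 : ∀ m y, 0 ≤ V m y := fun m y =>
      mul_nonneg (bk_nonneg hp1 hp11 _ _) (bk_nonneg hq0 (by linarith) _ _)
    have hm1 : ∀ m (φ : (Fin n → Bool) → ℝ), ∑ y, V m y * φ y.1 = ∑ y, bk p1 n (f m) y * φ y := by
      intro m φ
      rw [Fintype.sum_prod_type]
      apply sum_congr rfl
      intro y _
      simp only [hV]
      rw [← sum_mul, ← mul_sum, bk_sum, mul_one]
    have hm2 : ∀ m (φ : (Fin n → Bool) → ℝ), ∑ y, V m y * φ y.2 = ∑ y, bk p2 n (f m) y * φ y := by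
      intro m φ
      rw [Fintype.sum_prod_type, sum_comm]
      apply sum_congr rfl
      intro y _
      simp only [hV]
      rw [← sum_mul, bk_comp, hq]
    have hV1 : ∀ m, ∑ y, V m y = 1 := by
      intro m
      have := hm1 m (fun _ => 1)
      simpa [bk_sum] using this
    have hEV : ∀ m, Ent (V m) = n * Real.binEntropy p1 + n * Real.binEntropy q := by
      intro m
      rw [hV]
      simp only
      rw [Ent_joint (bk p1 n (f m)) (bk q n) (bk_sum _ _) (fun a => bk_sum _ _) (fun a => Ent_bk q n a), Ent_bk]
    have hEA : Ent (fun y => (∑ m, V m y) / Fintype.card (Fin k1 × Fin k2)) ≤ n * Real.log 2 + n * Real.binEntropy q := by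
      set P : (Fin n → Bool) → ℝ := fun y => (∑ m, bk p1 n (f m) y) / Fintype.card (Fin k1 × Fin k2) with hP
      have hP1 : ∑ y, P y = 1 := by
        rw [hP]; simp only
        rw [← sum_div, sum_comm]
        simp [bk_sum, hk1'.ne', hk2'.ne']
      have e : (fun y => (∑ m, V m y) / (Fintype.card (Fin k1 × Fin k2) : ℝ)) = fun y => P y.1 * bk q n y.1 y.2 := by
        funext y
        simp only [hV, hP, ← sum_mul]
        ring
      rw [e, Ent_joint P (bk q n) hP1 (fun a => bk_sum _ _) (fun a => Ent_bk q n a)]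
      have := Ent_bool_le P (fun y => div_nonneg (sum_nonneg fun _ _ => bk_nonneg hp1 hp11 _ _) (Nat.cast_nonneg _)) hP1
      linarith
    have hf := fano_e V hV0 hV1 (fun y => (g1 y.1, g2 (y.2, g1 y.1))) he0 he1 (e := e) (by
      have hb : ∀ m, ∑ y, V m y * (if (g1 y.1, g2 (y.2, g1 y.1)) = m then 0 else 1) ≤
          ∑ y, bk p1 n (f m) y * (if g1 y = m.1 then 0 else 1) +
          ∑ y, bk p2 n (f m) y * (if g2 (y, m.1) = m.2 then 0 else 1) := by
        intro m
        rw [← hm1 m (fun y => if g1 y = m.1 then 0 else 1), ← hm2 m (fun y => if g2 (y, m.1) = m.2 then 0 else 1),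
          ← sum_add_distrib]
        apply sum_le_sum
        intro y _
        rw [← mul_add]
        apply mul_le_mul_of_nonneg_left _ (hV0 m y)
        by_cases a : g1 y.1 = m.1
        · by_cases b : g2 (y.2, m.1) = m.2
          · simp [a, b]
          · simp [a, b]; split_ifs <;> norm_num
        · simp [a]; split_ifs <;> norm_num
      have hs := sum_le_sum fun m (_ : m ∈ (univ : Finset (Fin k1 × Fin k2))) => hb m
      rw [sum_add_distrib, Fintype.sum_prod_type (f := fun m => ∑ y, bk p1 n (f m) y * (if g1 y = m.1 then 0 else 1)),
        Fintype.sum_prod_type (f := fun m => ∑ y, bk p2 n (f m) y * (if g2 (y, m.1) = m.2 then 0 else 1))] at hs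
      have hc : (Fintype.card (Fin k1 × Fin k2) : ℝ) = k1 * k2 := by simp
      rw [hc, div_le_iff₀ (by positivity)]
      rw [div_le_iff₀ (by positivity)] at h1 h2
      refine hs.trans ?_
      simp only
      linarith)
    have hc : (Fintype.card (Fin k1 × Fin k2) : ℝ) = k1 * k2 := by simp
    simp only [hEV, sum_const, card_univ, nsmul_eq_mul] at hf
    rw [mul_div_cancel_left₀ _ (by rw [hc]; positivity)] at hf
    rw [← Real.log_mul hk1'.ne' hk2'.ne', ← hc]
    unfold etaS
    linarith

lemma Hb_cont : Continuous Hb := by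
  have : Hb = fun x => Real.binEntropy x / Real.log 2 := funext Hb_eq
  rw [this]
  exact Real.binEntropy_continuous.div_const _

lemma CBSBC_closed (p1 p2 : ℝ) : IsClosed (CBSBC p1 p2) := by
  have hH := Hb_cont
  have hS : IsClosed {z : Set.Icc (0:ℝ) (1/2) × (ℝ × ℝ) | 0 ≤ z.2.1 ∧ 0 ≤ z.2.2 ∧
      z.2.1 ≤ Hb (bconv z.1 p1) - Hb p1 ∧ z.2.2 ≤ 1 - Hb (bconv z.1 p2)} := by
    have c1 : Continuous fun z : Set.Icc (0:ℝ) (1/2) × (ℝ × ℝ) => Hb (bconv z.1 p1) - Hb p1 := by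
      refine Continuous.sub (hH.comp ?_) continuous_const
      unfold bconv; fun_prop
    have c2 : Continuous fun z : Set.Icc (0:ℝ) (1/2) × (ℝ × ℝ) => 1 - Hb (bconv z.1 p2) := by
      refine Continuous.sub continuous_const (hH.comp ?_)
      unfold bconv; fun_prop
    simp only [Set.setOf_and]
    refine IsClosed.inter (isClosed_le continuous_const ?_) (IsClosed.inter (isClosed_le continuous_const ?_)
      (IsClosed.inter (isClosed_le ?_ c1) (isClosed_le ?_ c2))) <;> fun_prop
  have := isClosedMap_snd_of_compactSpace _ hS
  convert this using 1
  ext R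
  constructor
  · rintro ⟨h1, h2, α, hα, h3, h4⟩
    exact ⟨(⟨α, hα⟩, R), ⟨h1, h2, h3, h4⟩, rfl⟩
  · rintro ⟨⟨⟨α, hα⟩, R'⟩, ⟨h1, h2, h3, h4⟩, rfl⟩
    exact ⟨h1, h2, α, hα, h3, h4⟩

lemma binEnt_mono {a b : ℝ} (ha : 0 ≤ a) (hab : a ≤ b) (hb : b ≤ 1/2) :
    Real.binEntropy a ≤ Real.binEntropy b := by
  have := Real.binEntropy_strictMonoOn.monotoneOn
  exact this ⟨ha, by linarith⟩ ⟨by linarith, by linarith⟩ hab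

lemma le_bconv {a p : ℝ} (ha0 : 0 ≤ a) (hp : p ≤ 1/2) : p ≤ bconv a p := by
  unfold bconv; nlinarith

lemma rate_conv {R B e : ℝ} {n k : ℕ} (hn : 0 < n) (he0 : 0 < e) (he1 : e < 1)
    (hR : R ≤ Real.logb 2 k / n) (h : (1 - e) * Real.log k ≤ n * B + etaS e) :
    (1 - e) * R - etaS e / Real.log 2 ≤ B / Real.log 2 := by
  have hl : 0 < Real.log 2 := Real.log_pos (by norm_num)
  have hn' : (1:ℝ) ≤ n := by exact_mod_cast hn
  have h0 := etaS_nonneg he0 he1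
  rw [Real.logb, div_div, le_div_iff₀ (by positivity)] at hR
  rw [sub_le_iff_le_add, ← add_div, le_div_iff₀ hl]
  have h1 : (1 - e) * (R * (Real.log 2 * n)) ≤ (1 - e) * Real.log k :=
    mul_le_mul_of_nonneg_left hR (by linarith)
  refine le_of_mul_le_mul_left (a := (n:ℝ)) ?_ (by linarith)
  nlinarith

lemma conv1 {p1 p2 : ℝ} (hp1 : 0 ≤ p1) (hp12 : p1 ≤ p2) (hp2 : p2 ≤ 1/2)
    {W : Bool → Bool × Bool → ℝ} (hW : IsChannel W)
    (hm1 : ∀ x y, margW1 W x y = BSCk p1 x y)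
    (hm2 : ∀ x y, margW2 W x y = BSCk p2 x y) {R : ℝ × ℝ} (hR : Ach1 W R) : R ∈ CBSBC p1 p2 := by
  obtain ⟨hR1, hR2, h⟩ := hR
  have hl : 0 < Real.log 2 := Real.log_pos (by norm_num)
  have key : ∀ e : ℝ, 0 < e → e < 1 →
      (max 0 ((1 - e) * R.1 - etaS e / Real.log 2), max 0 ((1 - e) * R.2 - etaS e / Real.log 2))
        ∈ CBSBC p1 p2 := by
    intro e he0 he1
    obtain ⟨n, k1, k2, hn, hk1, hk2, f, g1, g2, hr1, hr2, herr⟩ := h e he0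
    have hk1' : (0:ℝ) < k1 := by exact_mod_cast hk1
    have hk2' : (0:ℝ) < k2 := by exact_mod_cast hk2
    unfold errP1 at herr
    rw [one_div, inv_mul_eq_div, Fintype.sum_prod_type_right] at herr
    obtain ⟨α, hα, c1, c2⟩ := conv1_core hp1 hp12 hp2 hn hk1 hk2 f g1 g2 he0 he1 (by
        refine le_trans ?_ herr
        gcongr with m2 _ m1 _
        rw [← sum_marg1 hm1 _ (fun y => if g1 (y, m2) = m1 then 0 else 1)]
        exact err_ge hW _ (fun y => g1 (y.1, m2) = m1) (fun y => g2 y.2 = m2)) (by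
        refine le_trans ?_ herr
        gcongr with m2 _ m1 _
        rw [← sum_marg2 hm2 _ (fun y => if g2 y = m2 then 0 else 1)]
        exact err_ge' hW _ (fun y => g1 (y.1, m2) = m1) (fun y => g2 y.2 = m2))
    have d1 := rate_conv hn he0 he1 hr1 c1
    have d2 := rate_conv hn he0 he1 hr2 c2
    refine ⟨le_max_left _ _, le_max_left _ _, α, hα, ?_, ?_⟩
    · refine max_le ?_ ?_
      · rw [Hb_eq, Hb_eq, ← sub_div]
        refine div_nonneg ?_ hl.le
        linarith [binEnt_mono hp1 (le_bconv hα.1 (hp12.trans hp2)) (bconv_le hα.2 (hp12.trans hp2))]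
      · rw [Hb_eq, Hb_eq, ← sub_div]; exact d1
    · refine max_le ?_ ?_
      · rw [Hb_eq, sub_nonneg, div_le_one hl]
        exact Real.binEntropy_le_log_two
      · rw [Hb_eq]
        refine d2.trans (le_of_eq ?_)
        field_simp
  have hlim : Filter.Tendsto (fun e : ℝ => (max 0 ((1 - e) * R.1 - etaS e / Real.log 2),
      max 0 ((1 - e) * R.2 - etaS e / Real.log 2))) (nhdsWithin 0 (Set.Ioi 0)) (nhds R) := by
    have g : ∀ r : ℝ, 0 ≤ r → Filter.Tendsto (fun e : ℝ => max 0 ((1 - e) * r - etaS e / Real.log 2))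
        (nhdsWithin 0 (Set.Ioi 0)) (nhds r) := by
      intro r hr
      have h1 : Filter.Tendsto (fun e : ℝ => (1 - e) * r) (nhdsWithin 0 (Set.Ioi 0)) (nhds ((1 - 0) * r)) :=
        (Continuous.tendsto (by fun_prop) 0).mono_left nhdsWithin_le_nhds
      have h2 := (tendsto_const_nhds (x := (0:ℝ))).max (h1.sub (etaS_tendsto.div_const (Real.log 2)))
      simpa [hr] using h2
    exact (g R.1 hR1).prodMk_nhds (g R.2 hR2)
  refine (CBSBC_closed p1 p2).mem_of_tendsto hlim ?_
  filter_upwards [Ioo_mem_nhdsGT (show (0:ℝ) < 1 by norm_num)] with e he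
  exact key e he.1 he.2

lemma conv2 {p1 p2 : ℝ} (hp1 : 0 ≤ p1) (hp12 : p1 ≤ p2) (hp2 : p2 ≤ 1/2)
    {W : Bool → Bool × Bool → ℝ} (hW : IsChannel W)
    (hm1 : ∀ x y, margW1 W x y = BSCk p1 x y)
    (hm2 : ∀ x y, margW2 W x y = BSCk p2 x y) {R : ℝ × ℝ} (hR : Ach2 W R) :
    R.2 ≤ 1 - Hb p2 ∧ R.1 + R.2 ≤ 1 - Hb p1 := by
  obtain ⟨hR1, hR2, h⟩ := hR
  have hl : 0 < Real.log 2 := Real.log_pos (by norm_num)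
  have key : ∀ e : ℝ, 0 < e → e < 1 →
      (1 - e) * R.2 - etaS e / Real.log 2 ≤ 1 - Hb p2 ∧
      (1 - e) * (R.1 + R.2) - etaS e / Real.log 2 ≤ 1 - Hb p1 := by
    intro e he0 he1
    obtain ⟨n, k1, k2, hn, hk1, hk2, f, g1, g2, hr1, hr2, herr⟩ := h (e/2) (by linarith)
    have hk1' : (0:ℝ) < k1 := by exact_mod_cast hk1
    have hk2' : (0:ℝ) < k2 := by exact_mod_cast hk2
    unfold errP2 at herr
    rw [one_div, inv_mul_eq_div, Fintype.sum_prod_type] at herr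
    obtain ⟨c1, c2⟩ := conv2_core hp1 hp12 hp2 hk1 hk2 f g1 g2 he0 he1 (by
        refine le_trans ?_ herr
        gcongr with m1 _ m2 _
        rw [← sum_marg1 hm1 _ (fun y => if g1 y = m1 then 0 else 1)]
        exact err_ge hW _ (fun y => g1 y.1 = m1) (fun y => g2 (y.2, m1) = m2)) (by
        refine le_trans ?_ herr
        gcongr with m1 _ m2 _
        rw [← sum_marg2 hm2 _ (fun y => if g2 (y, m1) = m2 then 0 else 1)]
        exact err_ge' hW _ (fun y => g1 y.1 = m1) (fun y => g2 (y.2, m1) = m2))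
    have d1 := rate_conv hn he0 he1 hr2 c1
    have d2 := rate_conv (k := k1 * k2) hn he0 he1 (R := R.1 + R.2) (by
      push_cast
      rw [Real.logb_mul hk1'.ne' hk2'.ne', add_div]
      exact add_le_add hr1 hr2) (by
      push_cast
      rw [Real.log_mul hk1'.ne' hk2'.ne']
      exact c2)
    rw [Hb_eq, Hb_eq]
    rw [sub_div, div_self hl.ne'] at d1 d2
    exact ⟨d1, d2⟩
  have g : ∀ r : ℝ, Filter.Tendsto (fun e : ℝ => ((1 - e) * r - etaS e / Real.log 2))
      (nhdsWithin 0 (Set.Ioi 0)) (nhds r) := by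
    intro r
    have h1 : Filter.Tendsto (fun e : ℝ => (1 - e) * r) (nhdsWithin 0 (Set.Ioi 0)) (nhds ((1 - 0) * r)) :=
      (Continuous.tendsto (by fun_prop) 0).mono_left nhdsWithin_le_nhds
    have h2 := (h1.sub (etaS_tendsto.div_const (Real.log 2)))
    simpa using h2
  constructor
  · refine le_of_tendsto (g _) ?_
    filter_upwards [Ioo_mem_nhdsGT (show (0:ℝ) < 1 by norm_num)] with e he
    exact (key e he.1 he.2).1
  · refine le_of_tendsto (g _) ?_
    filter_upwards [Ioo_mem_nhdsGT (show (0:ℝ) < 1 by norm_num)] with e he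
    exact (key e he.1 he.2).2

lemma ach0_ach1 {W : Bool → Bool × Bool → ℝ} {R : ℝ × ℝ} (h : Ach0 W R) : Ach1 W R := by
  obtain ⟨a, b, h⟩ := h
  refine ⟨a, b, fun ε hε => ?_⟩
  obtain ⟨n, k1, k2, hn, hk1, hk2, f, g1, g2, h⟩ := h ε hε
  exact ⟨n, k1, k2, hn, hk1, hk2, f, fun y => g1 y.1, g2, h⟩

lemma region2_closed (p1 p2 : ℝ) : IsClosed {R : ℝ × ℝ | 0 ≤ R.1 ∧ 0 ≤ R.2 ∧
      R.2 ≤ 1 - Hb p2 ∧ R.1 + R.2 ≤ 1 - Hb p1} := by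
  simp only [Set.setOf_and]
  refine IsClosed.inter (isClosed_le continuous_const ?_) (IsClosed.inter (isClosed_le continuous_const ?_)
      (IsClosed.inter (isClosed_le ?_ continuous_const) (isClosed_le ?_ continuous_const))) <;> fun_prop

lemma moments {A : Type} [Fintype A] (μ g : A → ℝ) (h1 : ∑ a, μ a = 1) (h0 : ∑ a, μ a * g a = 0) :
    ∀ n : ℕ, (∑ a : Fin n → A, ∏ t, μ (a t)) = 1 ∧
      (∑ a : Fin n → A, (∏ t, μ (a t)) * ∑ t, g (a t)) = 0 ∧
      (∑ a : Fin n → A, (∏ t, μ (a t)) * (∑ t, g (a t))^2) = n * ∑ a, μ a * g a ^ 2 := by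
  intro n
  induction n with
  | zero => simp
  | succ n ih =>
    obtain ⟨i1, i2, i3⟩ := ih
    refine ⟨?_, ?_, ?_⟩
    · rw [sumBoolCons]
      simp only [Fin.prod_univ_succ, Fin.cons_zero, Fin.cons_succ, ← mul_sum, i1, mul_one, h1]
    · rw [sumBoolCons]
      simp only [Fin.prod_univ_succ, Fin.sum_univ_succ, Fin.cons_zero, Fin.cons_succ]
      have : ∀ a : A, ∑ x : Fin n → A, μ a * (∏ i, μ (x i)) * (g a + ∑ i, g (x i)) =
          μ a * g a * (∑ x : Fin n → A, ∏ i, μ (x i)) +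
          μ a * ∑ x : Fin n → A, (∏ i, μ (x i)) * ∑ i, g (x i) := by
        intro a
        rw [mul_sum, mul_sum, ← sum_add_distrib]
        exact sum_congr rfl fun _ _ => by ring
      simp only [this, i1, i2, mul_one, mul_zero, add_zero, h0]
    · rw [sumBoolCons]
      simp only [Fin.prod_univ_succ, Fin.sum_univ_succ, Fin.cons_zero, Fin.cons_succ]
      have : ∀ a : A, ∑ x : Fin n → A, μ a * (∏ i, μ (x i)) * (g a + ∑ i, g (x i))^2 =
          μ a * g a ^ 2 * (∑ x : Fin n → A, ∏ i, μ (x i)) +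
          2 * μ a * g a * (∑ x : Fin n → A, (∏ i, μ (x i)) * ∑ i, g (x i)) +
          μ a * ∑ x : Fin n → A, (∏ i, μ (x i)) * (∑ i, g (x i))^2 := by
        intro a
        rw [mul_sum, mul_sum, mul_sum, ← sum_add_distrib, ← sum_add_distrib]
        exact sum_congr rfl fun _ _ => by ring
      simp only [this, i1, i2, i3, mul_one, mul_zero, add_zero, sum_add_distrib, ← sum_mul, h1]
      push_cast; ring

lemma cheb {A : Type} [Fintype A] (μ f : A → ℝ) (hμ : ∀ a, 0 ≤ μ a) (h1 : ∑ a, μ a = 1)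
    {m δ : ℝ} (hm : ∑ a, μ a * f a = m) (hδ : 0 < δ) {n : ℕ} (hn : 0 < n) :
    ∑ a : Fin n → A, (∏ t, μ (a t)) * (if n * (m - δ) ≤ ∑ t, f (a t) then 0 else 1)
      ≤ (∑ a, μ a * (f a - m)^2) / δ^2 * (1 / (n:ℝ)) := by
  have hn' : (0:ℝ) < n := by exact_mod_cast hn
  have h0 : ∑ a, μ a * (f a - m) = 0 := by
    simp only [mul_sub, sum_sub_distrib, ← sum_mul, hm, h1]; ring
  have h2 := (moments μ (fun a => f a - m) h1 h0 n).2.2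
  have : (∑ a, μ a * (f a - m)^2) / δ^2 * (1 / (n:ℝ)) =
    ∑ a : Fin n → A, (∏ t, μ (a t)) * ((∑ t, (f (a t) - m))^2 / (n * δ)^2) := by
    simp only [← mul_div_assoc, ← sum_div]
    rw [h2]
    field_simp
  rw [this]
  apply sum_le_sum
  intro a _
  apply mul_le_mul_of_nonneg_left _ (prod_nonneg fun _ _ => hμ _)
  split_ifs with h
  · positivity
  · rw [le_div_iff₀ (by positivity), one_mul]
    simp only [sum_sub_distrib, sum_const, card_univ, Fintype.card_fin, nsmul_eq_mul]
    push Not at h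
    have : 0 < n * δ := by positivity
    nlinarith

/-- The all-`false` word. -/
def zw (n : ℕ) : Fin n → Bool := fun _ => false

/-- Failure probability of a test. -/
def failP (a p : ℝ) (n : ℕ) (T : (Fin n → Bool) → (Fin n → Bool) → Prop) : ℝ :=
  ∑ x, ∑ y, bk a n (zw n) x * bk p n x y * (if T x y then 0 else 1)

/-- False alarm probability of a test. -/
def passP (a p : ℝ) (n : ℕ) (T : (Fin n → Bool) → (Fin n → Bool) → Prop) : ℝ :=
  ∑ x, ∑ y, bk a n (zw n) x * bk (bconv a p) n (zw n) y * (if T x y then 1 else 0)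

lemma sum_pairs {n : ℕ} {A B : Type} [Fintype A] [Fintype B] (F : (Fin n → A) → (Fin n → B) → ℝ) :
    ∑ a : Fin n → A × B, F (fun t => (a t).1) (fun t => (a t).2) = ∑ x, ∑ y, F x y := by
  rw [← Fintype.sum_prod_type']
  exact Fintype.sum_equiv (Equiv.arrowProdEquivProdArrow (Fin n) (fun _ => A) (fun _ => B)) _ _ (fun _ => rfl)

lemma mean_info (a p : ℝ) : ∑ z : Bool × Bool, BSCk a false z.1 * BSCk p z.1 z.2 *
    (Real.log (BSCk p z.1 z.2) - Real.log (BSCk (bconv a p) false z.2)) =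
    Real.binEntropy (bconv a p) - Real.binEntropy p := by
  rw [Fintype.sum_prod_type]
  simp only [Fintype.sum_bool, BSCk, Real.binEntropy, Real.log_inv, bconv]
  simp
  ring

lemma bconv_mem {a p : ℝ} (ha0 : 0 ≤ a) (ha1 : a ≤ 1) (hp0 : 0 ≤ p) (hp1 : p ≤ 1) :
    0 ≤ bconv a p ∧ bconv a p ≤ 1 := by
  unfold bconv
  constructor
  · have : 0 ≤ 1 - p := by linarith
    have : 0 ≤ 1 - a := by linarith
    positivity
  · nlinarith [mul_nonneg ha0 hp0, mul_nonneg (sub_nonneg.2 ha1) (sub_nonneg.2 hp1)]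

lemma fail_bound {a p : ℝ} (ha0 : 0 ≤ a) (ha1 : a ≤ 1) (hp0 : 0 ≤ p) (hp1 : p ≤ 1) {δ : ℝ} (hδ : 0 < δ) :
    ∃ C : ℝ, ∀ n : ℕ, 0 < n → failP a p n (fun x y =>
      Real.exp (n * (Real.binEntropy (bconv a p) - Real.binEntropy p - δ)) * bk (bconv a p) n (zw n) y ≤ bk p n x y)
      ≤ C * (1 / (n:ℝ)) := by
  set m := Real.binEntropy (bconv a p) - Real.binEntropy p with hm
  set μ : Bool × Bool → ℝ := fun z => BSCk a false z.1 * BSCk p z.1 z.2 with hμ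
  set f : Bool × Bool → ℝ := fun z =>
    (Real.log (BSCk p z.1 z.2) - Real.log (BSCk (bconv a p) false z.2)) with hf
  have hμ0 : ∀ z, 0 ≤ μ z := fun z => mul_nonneg (BSCk_nonneg ha0 ha1 _ _) (BSCk_nonneg hp0 hp1 _ _)
  have hμ1 : ∑ z, μ z = 1 := by
    rw [Fintype.sum_prod_type]
    simp only [Fintype.sum_bool, BSCk, hμ]
    simp
    ring
  refine ⟨(∑ a, μ a * (f a - m)^2) / δ^2, fun n hn => ?_⟩
  refine le_trans ?_ (cheb μ f hμ0 hμ1 (mean_info a p) hδ hn)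
  unfold failP
  rw [← sum_pairs]
  apply sum_le_sum
  intro z _
  have e : bk a n (zw n) (fun t => (z t).1) * bk p n (fun t => (z t).1) (fun t => (z t).2) = ∏ t, μ (z t) := by
    simp only [bk, zw, hμ, prod_mul_distrib]
  rw [e]
  by_cases h0 : ∏ t, μ (z t) = 0
  · rw [h0]; simp
  apply mul_le_mul_of_nonneg_left _ (prod_nonneg fun _ _ => hμ0 _)
  by_cases h : n * (m - δ) ≤ ∑ t, f (z t)
  · rw [if_pos h, if_pos]
    have hz : ∀ t, 0 < μ (z t) := fun t => (hμ0 _).lt_of_ne' (fun h => h0 (prod_eq_zero (mem_univ t) h))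
    have hw : ∀ t, 0 < BSCk p (z t).1 (z t).2 := fun t =>
      (BSCk_nonneg hp0 hp1 _ _).lt_of_ne' (fun h => (hz t).ne' (by simp [hμ, h]))
    have hP : ∀ t, 0 < BSCk a false (z t).1 := fun t =>
      (BSCk_nonneg ha0 ha1 _ _).lt_of_ne' (fun h => (hz t).ne' (by simp [hμ, h]))
    have hq : ∀ t, 0 < BSCk (bconv a p) false (z t).2 := by
      intro t
      rw [← BSCk_comp]
      refine lt_of_lt_of_le (mul_pos (hP t) (hw t)) ?_
      exact single_le_sum (f := fun x => BSCk a false x * BSCk p x (z t).2)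
        (fun x _ => mul_nonneg (BSCk_nonneg ha0 ha1 _ _) (BSCk_nonneg hp0 hp1 _ _)) (mem_univ _)
    have e1 : bk p n (fun t => (z t).1) (fun t => (z t).2) =
        Real.exp (∑ t, f (z t)) * bk (bconv a p) n (zw n) (fun t => (z t).2) := by
      rw [Real.exp_sum]
      unfold bk
      rw [← prod_mul_distrib]
      apply prod_congr rfl
      intro t _
      simp only [hf, zw]
      rw [Real.exp_sub, Real.exp_log (hw t), Real.exp_log (hq t), div_mul_cancel₀ _ (hq t).ne']
    beta_reduce
    rw [e1]
    apply mul_le_mul_of_nonneg_right (Real.exp_le_exp.2 h)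
    exact prod_nonneg fun t _ => (hq t).le
  · rw [if_neg h]
    split_ifs <;> norm_num

lemma pass_bound {a p : ℝ} (ha0 : 0 ≤ a) (ha1 : a ≤ 1) (hp0 : 0 ≤ p) (hp1 : p ≤ 1) (g : ℝ) (n : ℕ) :
    passP a p n (fun x y => Real.exp g * bk (bconv a p) n (zw n) y ≤ bk p n x y) ≤ Real.exp (-g) := by
  obtain ⟨hb0, hb1⟩ := bconv_mem ha0 ha1 hp0 hp1
  have : Real.exp (-g) = ∑ x, ∑ y, bk a n (zw n) x * (Real.exp (-g) * bk p n x y) := by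
    simp only [← mul_sum, ← sum_mul, bk_sum, mul_one]
    simp
  rw [this]
  unfold passP
  apply sum_le_sum; intro x _
  apply sum_le_sum; intro y _
  rw [mul_assoc]
  apply mul_le_mul_of_nonneg_left _ (bk_nonneg ha0 ha1 _ _)
  split_ifs with h
  · rw [Real.exp_neg, mul_one, ← div_eq_inv_mul, le_div_iff₀ (Real.exp_pos _)]
    linarith
  · rw [mul_zero]
    exact mul_nonneg (Real.exp_pos _).le (bk_nonneg hp0 hp1 _ _)

lemma passP_nonneg {a p : ℝ} (ha0 : 0 ≤ a) (ha1 : a ≤ 1) (hp0 : 0 ≤ p) (hp1 : p ≤ 1) (n : ℕ) (T) :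
    0 ≤ passP a p n T := by
  obtain ⟨hb0, hb1⟩ := bconv_mem ha0 ha1 hp0 hp1
  unfold passP
  refine sum_nonneg fun x _ => sum_nonneg fun y _ => ?_
  refine mul_nonneg (mul_nonneg (bk_nonneg ha0 ha1 _ _) (bk_nonneg hb0 hb1 _ _)) ?_
  split_ifs <;> norm_num

lemma test_exists {a p : ℝ} (ha0 : 0 ≤ a) (ha1 : a ≤ 1) (hp0 : 0 ≤ p) (hp1 : p ≤ 1) (r : ℝ) {ε : ℝ} (hε : 0 < ε) :
    ∃ N : ℕ, ∀ n : ℕ, N ≤ n → ∀ K : ℝ, 0 ≤ K →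
      (K = 0 ∨ (r < Real.binEntropy (bconv a p) - Real.binEntropy p ∧ K ≤ 3 * Real.exp (n * r))) →
      ∃ T, failP a p n T + K * passP a p n T ≤ ε := by
  by_cases hr : r < Real.binEntropy (bconv a p) - Real.binEntropy p
  · set m := Real.binEntropy (bconv a p) - Real.binEntropy p with hm
    set δ := (m - r) / 2 with hδ
    have hδ0 : 0 < δ := by rw [hδ]; linarith
    obtain ⟨C, hC⟩ := fail_bound ha0 ha1 hp0 hp1 hδ0
    have l1 : Filter.Tendsto (fun n : ℕ => C * (1 / (n:ℝ)) + 3 * Real.exp (-(n * δ))) Filter.atTop (nhds (C * 0 + 3 * 0)) := by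
      refine (tendsto_one_div_atTop_nhds_zero_nat.const_mul C).add (Filter.Tendsto.const_mul 3 ?_)
      refine Real.tendsto_exp_neg_atTop_nhds_zero.comp ?_
      exact tendsto_natCast_atTop_atTop.atTop_mul_const hδ0
    have l2 := l1.eventually (gt_mem_nhds (show C * 0 + 3 * 0 < ε by simpa using hε))
    obtain ⟨N, hN⟩ := Filter.eventually_atTop.1 (l2.and (Filter.eventually_gt_atTop 0))
    refine ⟨N, fun n hn K hK h => ⟨_, le_trans (add_le_add (hC n (hN n hn).2)
      (mul_le_mul_of_nonneg_left (pass_bound ha0 ha1 hp0 hp1 (n * (m - δ)) n) hK)) (le_trans ?_ (hN n hn).1.le)⟩⟩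
    refine add_le_add le_rfl ?_
    have hK3 : K ≤ 3 * Real.exp (n * r) := by
      rcases h with h | h
      · rw [h]; positivity
      · exact h.2
    refine (mul_le_mul_of_nonneg_right hK3 (Real.exp_pos _).le).trans (le_of_eq ?_)
    rw [mul_assoc, ← Real.exp_add]
    congr 2
    rw [hδ]; ring
  · refine ⟨0, fun n _ K hK h => ⟨fun _ _ => True, ?_⟩⟩
    rcases h with h | h
    · rw [h]; simp [failP, hε.le]
    · exact absurd h.1 hr

section RC
variable {ι X Y : Type} [Fintype ι] [DecidableEq ι] [Fintype X] [Fintype Y]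

/-- Weight of a random codebook. -/
def cw (P : X → ℝ) (c : ι → X) : ℝ := ∏ i, P (c i)

lemma cw_gen (P : X → ℝ) (g : ι → X → ℝ) :
    ∑ c : ι → X, cw P c * ∏ i, g i (c i) = ∏ i, ∑ x, P x * g i x := by
  rw [Finset.prod_univ_sum]
  rw [Fintype.piFinset_univ]
  apply sum_congr rfl
  intro c _
  rw [cw, ← prod_mul_distrib]

lemma cw_sum (P : X → ℝ) (hP : ∑ x, P x = 1) : ∑ c : ι → X, cw P c = 1 := by
  have := cw_gen (ι := ι) P (fun _ _ => 1)
  simpa [hP] using this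

lemma cw_one (P : X → ℝ) (hP : ∑ x, P x = 1) (i : ι) (φ : X → ℝ) :
    ∑ c : ι → X, cw P c * φ (c i) = ∑ x, P x * φ x := by
  have := cw_gen (ι := ι) P (fun k x => if k = i then φ x else 1)
  rw [Finset.prod_eq_single i (by
    intro b _ hb; simp [hb, hP]) (by simp)] at this
  simp only [if_true] at this
  rw [← this]
  apply sum_congr rfl
  intro c _
  rw [Finset.prod_eq_single i (by intro b _ hb; simp [hb]) (by simp)]
  simp

lemma cw_two (P : X → ℝ) (hP : ∑ x, P x = 1) {i j : ι} (hij : i ≠ j) (φ : X → X → ℝ) :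
    ∑ c : ι → X, cw P c * φ (c i) (c j) = ∑ x, P x * ∑ x', P x' * φ x x' := by
  have key : ∀ u, ∑ c : ι → X, cw P c * ((if c i = u then 1 else 0) * φ u (c j)) = P u * ∑ x', P x' * φ u x' := by
    intro u
    have := cw_gen (ι := ι) P (fun k x => if k = i then (if x = u then 1 else 0) else if k = j then φ u x else 1)
    rw [Finset.prod_eq_mul i j hij (by
      rintro b _ ⟨hb, hb'⟩; simp [hb, hb', hP]) (by simp) (by simp)] at this
    simp only [if_true, hij.symm, if_false] at this
    have e : ∑ x, P x * (if x = u then (1:ℝ) else 0) = P u := by simp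
    rw [e] at this
    rw [← this]
    apply sum_congr rfl
    intro c _
    rw [Finset.prod_eq_mul i j hij (by rintro b _ ⟨hb, hb'⟩; simp [hb, hb']) (by simp) (by simp)]
    simp [hij.symm]
  rw [← sum_congr rfl fun u _ => key u, sum_comm]
  apply sum_congr rfl
  intro c _
  rw [← mul_sum]
  simp

/-- Unique-candidate threshold decoder. -/
def dec [Nonempty ι] (T : X → Y → Prop) (S : Finset ι) (c : ι → X) (y : Y) : ι :=
  if h : ∃ i, i ∈ S ∧ T (c i) y ∧ ∀ j ∈ S, j ≠ i → ¬ T (c j) y then Classical.choose h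
  else Classical.arbitrary ι

lemma dec_err [Nonempty ι] (T : X → Y → Prop) (S : Finset ι) (c : ι → X) (y : Y) {i : ι} (hi : i ∈ S) :
    (if dec T S c y = i then (0:ℝ) else 1) ≤
      (if T (c i) y then 0 else 1) + ∑ j ∈ S.erase i, (if T (c j) y then 1 else 0) := by
  have hs : (0:ℝ) ≤ ∑ j ∈ S.erase i, (if T (c j) y then 1 else 0) :=
    sum_nonneg fun j _ => by split_ifs <;> norm_num
  by_cases hT : T (c i) y
  · by_cases hj : ∃ j ∈ S.erase i, T (c j) y
    · obtain ⟨j, hjS, hjT⟩ := hj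
      have : (1:ℝ) ≤ ∑ j ∈ S.erase i, (if T (c j) y then 1 else 0) := by
        have := single_le_sum (f := fun j => if T (c j) y then (1:ℝ) else 0)
          (fun j _ => by beta_reduce; split_ifs <;> norm_num) hjS
        simpa [hjT] using this
      split_ifs <;> linarith
    · push Not at hj
      have hd : dec T S c y = i := by
        have h : ∃ i, i ∈ S ∧ T (c i) y ∧ ∀ j ∈ S, j ≠ i → ¬ T (c j) y :=
          ⟨i, hi, hT, fun j hjS hji => hj j (mem_erase.2 ⟨hji, hjS⟩)⟩
        unfold dec
        rw [dif_pos h]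
        by_contra hne
        exact hj _ (mem_erase.2 ⟨hne, (Classical.choose_spec h).1⟩) (Classical.choose_spec h).2.1
      rw [if_pos hd, if_pos hT]
      linarith
  · rw [if_neg hT]
    split_ifs <;> linarith

lemma cw_nonneg (P : X → ℝ) (hP0 : ∀ x, 0 ≤ P x) (c : ι → X) : 0 ≤ cw P c := prod_nonneg fun _ _ => hP0 _

lemma rc [Nonempty ι] (P : X → ℝ) (hP0 : ∀ x, 0 ≤ P x) (hP : ∑ x, P x = 1) (V : X → Y → ℝ)
    (hV : ∀ x y, 0 ≤ V x y) (Q : Y → ℝ) (hQ : ∀ y, ∑ x, P x * V x y = Q y)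
    (T : X → Y → Prop) (S : Finset ι) {i : ι} (hi : i ∈ S) :
    ∑ c : ι → X, cw P c * ∑ y, V (c i) y * (if dec T S c y = i then 0 else 1) ≤
      ∑ x, ∑ y, P x * V x y * (if T x y then 0 else 1) +
      ((S.card : ℝ) - 1) * ∑ x, ∑ y, P x * Q y * (if T x y then 1 else 0) := by
  have h1 : ∑ c : ι → X, cw P c * ∑ y, V (c i) y * (if dec T S c y = i then 0 else 1) ≤
      ∑ c : ι → X, (cw P c * ∑ y, V (c i) y * (if T (c i) y then 0 else 1) +
        ∑ j ∈ S.erase i, cw P c * ∑ y, V (c i) y * (if T (c j) y then 1 else 0)) := by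
    apply sum_le_sum
    intro c _
    rw [← mul_sum, ← mul_add]
    apply mul_le_mul_of_nonneg_left _ (cw_nonneg P hP0 c)
    rw [sum_comm, ← sum_add_distrib]
    apply sum_le_sum
    intro y _
    rw [← mul_sum, ← mul_add]
    exact mul_le_mul_of_nonneg_left (dec_err T S c y hi) (hV _ _)
  refine h1.trans (le_of_eq ?_)
  rw [sum_add_distrib, cw_one P hP i (fun x => ∑ y, V x y * (if T x y then 0 else 1)), sum_comm]
  congr 1
  · apply sum_congr rfl; intro x _
    rw [mul_sum]
    exact sum_congr rfl fun y _ => by ring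
  · have : ∀ j ∈ S.erase i, ∑ c : ι → X, cw P c * ∑ y, V (c i) y * (if T (c j) y then (1:ℝ) else 0) =
        ∑ x, ∑ y, P x * Q y * (if T x y then 1 else 0) := by
      intro j hj
      rw [cw_two P hP (ne_of_mem_erase hj) (fun x' x => ∑ y, V x y * (if T x' y then (1:ℝ) else 0))]
      apply sum_congr rfl; intro x' _
      simp only [mul_sum]
      rw [sum_comm]
      apply sum_congr rfl; intro y _
      rw [← hQ, mul_sum, sum_mul]
      exact sum_congr rfl fun x _ => by ring
    rw [sum_congr rfl this, sum_const, nsmul_eq_mul, card_erase_of_mem hi, Nat.cast_sub (card_pos.2 ⟨i, hi⟩)]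
    simp

lemma exists_of_avg {C : Type} [Fintype C] (w F : C → ℝ) (hw : ∀ c, 0 ≤ w c) (h1 : ∑ c, w c = 1) {ε : ℝ}
    (h : ∑ c, w c * F c ≤ ε) : ∃ c, F c ≤ ε := by
  by_contra hc
  push Not at hc
  have : ∑ c, w c * ε < ∑ c, w c * F c := by
    apply sum_lt_sum
    · intro c _; exact mul_le_mul_of_nonneg_left (hc c).le (hw c)
    · by_contra hh
      push Not at hh
      have : ∀ c, w c = 0 := by
        intro c
        by_contra h0
        have := (hw c).lt_of_ne' h0
        have h2 := hh c (mem_univ _)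
        have := mul_lt_mul_of_pos_left (hc c) this
        linarith
      simp [this] at h1
  rw [← sum_mul, h1, one_mul] at this
  linarith

end RC

lemma rc_bk {ι : Type} [Fintype ι] [DecidableEq ι] [Nonempty ι] {a p : ℝ} (ha0 : 0 ≤ a) (ha1 : a ≤ 1) (hp0 : 0 ≤ p) (hp1 : p ≤ 1)
    {n : ℕ} (T : (Fin n → Bool) → (Fin n → Bool) → Prop) (S : Finset ι) {i : ι} (hi : i ∈ S) :
    ∑ c : ι → Fin n → Bool, cw (bk a n (zw n)) c * ∑ y, bk p n (c i) y * (if dec T S c y = i then 0 else 1) ≤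
      failP a p n T + ((S.card : ℝ) - 1) * passP a p n T :=
  rc _ (fun _ => bk_nonneg ha0 ha1 _ _) (bk_sum _ _) _ (fun _ _ => bk_nonneg hp0 hp1 _ _) _
    (fun _ => bk_comp _ _ _ _) T S hi

/-- Bitwise xor of words. -/
def xr {n : ℕ} (u v : Fin n → Bool) : Fin n → Bool := fun t => xor (u t) (v t)

lemma xr_xr {n : ℕ} (u v : Fin n → Bool) : xr u (xr u v) = v := by
  funext t; simp [xr]

lemma BSCk_xor (p : ℝ) (a b c : Bool) : BSCk p (xor a b) (xor a c) = BSCk p b c := by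
  unfold BSCk; cases a <;> cases b <;> cases c <;> simp

lemma bk_xr (p : ℝ) {n : ℕ} (u v y : Fin n → Bool) : bk p n (xr u v) (xr u y) = bk p n v y := by
  unfold bk
  apply prod_congr rfl; intro t _
  exact BSCk_xor p _ _ _

lemma xr_zw {n : ℕ} (u : Fin n → Bool) : xr u (zw n) = u := by funext t; simp [xr, zw]

lemma sum_xr {n : ℕ} (u : Fin n → Bool) (F : (Fin n → Bool) → ℝ) : ∑ y, F (xr u y) = ∑ y, F y :=
  Equiv.sum_comp (Function.Involutive.toPerm (xr u) (xr_xr u)) F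

lemma xor_avg (a p : ℝ) {n : ℕ} (u : Fin n → Bool) (φ : (Fin n → Bool) → ℝ) :
    ∑ v, bk a n (zw n) v * ∑ y, bk p n (xr u v) y * φ y = ∑ y, bk (bconv a p) n u y * φ y := by
  rw [← sum_xr u]
  simp only [xr_xr]
  simp only [← bk_xr a u (zw n) (xr u _), xr_xr, xr_zw, mul_sum]
  rw [sum_comm]
  apply sum_congr rfl; intro y _
  rw [← bk_comp, sum_mul]
  exact sum_congr rfl fun x _ => by ring

lemma xor_shift (p : ℝ) {n : ℕ} (u v : Fin n → Bool) (φ : (Fin n → Bool) → ℝ) :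
    ∑ y, bk p n (xr u v) y * φ (xr u y) = ∑ y, bk p n v y * φ y := by
  rw [← sum_xr u]
  simp only [xr_xr, bk_xr]

/-- Codebook size. -/
def cs (n : ℕ) (r : ℝ) : ℕ := ⌈Real.exp (n * r)⌉₊

lemma cs_pos (n : ℕ) (r : ℝ) : 0 < cs n r := Nat.ceil_pos.2 (Real.exp_pos _)
lemma cs_zero (n : ℕ) : cs n 0 = 1 := by simp [cs]
lemma cs_le (n : ℕ) (r : ℝ) : (cs n r : ℝ) - 1 ≤ Real.exp (n * r) := by
  have := Nat.ceil_lt_add_one (Real.exp_pos (n * r)).le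
  unfold cs; linarith
lemma cs_ge (n : ℕ) (r : ℝ) : 0 ≤ (cs n r : ℝ) - 1 := by
  have : (1:ℝ) ≤ cs n r := by exact_mod_cast cs_pos n r
  linarith
lemma cs_rate {n : ℕ} (hn : 0 < n) (R : ℝ) : R ≤ Real.logb 2 (cs n (R * Real.log 2)) / n := by
  have hn' : (0:ℝ) < n := by exact_mod_cast hn
  have hl : 0 < Real.log 2 := Real.log_pos (by norm_num)
  rw [Real.logb, div_div, le_div_iff₀ (by positivity)]
  have h := Real.log_le_log (Real.exp_pos _) (Nat.le_ceil (Real.exp (n * (R * Real.log 2))))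
  rw [Real.log_exp] at h
  unfold cs
  linarith

lemma rate_strict {R I θ : ℝ} (hR : 0 < R) (hθ0 : 0 < θ) (h : R ≤ I / Real.log 2) :
    (1 - θ) * R * Real.log 2 < I := by
  have hl : 0 < Real.log 2 := Real.log_pos (by norm_num)
  rw [le_div_iff₀ hl] at h
  have : 0 < θ * (R * Real.log 2) := by positivity
  linarith

lemma cs_cond {R I θ : ℝ} (hR : 0 ≤ R) (hθ0 : 0 < θ) (h : R ≤ I / Real.log 2) (n : ℕ) :
    (cs n ((1 - θ) * R * Real.log 2) : ℝ) - 1 = 0 ∨ ((1 - θ) * R * Real.log 2 < I ∧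
      (cs n ((1 - θ) * R * Real.log 2) : ℝ) - 1 ≤ 3 * Real.exp (n * ((1 - θ) * R * Real.log 2))) := by
  rcases hR.eq_or_lt with h0 | h0
  · left; rw [← h0]; simp [cs_zero]
  · right
    refine ⟨rate_strict h0 hθ0 h, ?_⟩
    have := cs_le n ((1 - θ) * R * Real.log 2)
    have := Real.exp_pos (n * ((1 - θ) * R * Real.log 2))
    linarith

lemma avg_swap {C : Type} [Fintype C] {k1 k2 : ℕ} (pk1 : 0 < k1) (pk2 : 0 < k2) (w : C → ℝ)
    (G : C → Fin k1 × Fin k2 → ℝ) {ε : ℝ} (h : ∀ m, ∑ c, w c * G c m ≤ ε) :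
    ∑ c, w c * ((1 : ℝ) / ((k1 : ℝ) * (k2 : ℝ)) * ∑ m, G c m) ≤ ε := by
  have pk1' : (0:ℝ) < k1 := by exact_mod_cast pk1
  have pk2' : (0:ℝ) < k2 := by exact_mod_cast pk2
  have e : ∀ c, w c * ((1 : ℝ) / ((k1 : ℝ) * (k2 : ℝ)) * ∑ m, G c m) =
      (1 : ℝ) / ((k1 : ℝ) * (k2 : ℝ)) * ∑ m, w c * G c m := by
    intro c; rw [← mul_sum]; ring
  rw [sum_congr rfl fun c _ => e c, ← mul_sum, sum_comm, one_div, inv_mul_le_iff₀ (by positivity)]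
  refine (sum_le_sum fun m _ => h m).trans (le_of_eq ?_)
  simp

lemma ach_i {p1 p2 : ℝ} (hp1 : 0 ≤ p1) (hp12 : p1 ≤ p2) (hp2 : p2 ≤ 1/2)
    {W : Bool → Bool × Bool → ℝ} (hW : IsChannel W)
    (hm1 : ∀ x y, margW1 W x y = BSCk p1 x y)
    (hm2 : ∀ x y, margW2 W x y = BSCk p2 x y) {R : ℝ × ℝ} (hR : R ∈ CBSBC p1 p2)
    {θ : ℝ} (hθ0 : 0 < θ) (hθ1 : θ < 1) : Ach0 W ((1 - θ) * R.1, (1 - θ) * R.2) := by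
  obtain ⟨hR1, hR2, a, ⟨ha0, ha1⟩, h1, h2⟩ := hR
  have hl : 0 < Real.log 2 := Real.log_pos (by norm_num)
  refine ⟨mul_nonneg (by linarith) hR1, mul_nonneg (by linarith) hR2, fun ε hε => ?_⟩
  have hb1 := bconv_nonneg ha0 ha1 hp1 (hp12.trans hp2)
  have hb1' := bconv_le ha1 (hp12.trans hp2)
  have hb2 := bconv_nonneg ha0 ha1 (hp1.trans hp12) hp2
  have hb2' := bconv_le ha1 hp2
  have hbb : bconv a p1 ≤ bconv a p2 := by unfold bconv; nlinarith
  rw [Hb_eq, Hb_eq, ← sub_div] at h1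
  have hh : ∀ b, Real.binEntropy (bconv (1/2) b) = Real.log 2 := fun b => by
    rw [bconv_half, one_div, Real.binEntropy_two_inv]
  have h2' : R.2 ≤ (Real.binEntropy (bconv (1/2) (bconv a p2)) - Real.binEntropy (bconv a p2)) / Real.log 2 := by
    rw [hh, sub_div, div_self hl.ne', ← Hb_eq]; exact h2
  have h2'' : R.2 ≤ (Real.binEntropy (bconv (1/2) (bconv a p1)) - Real.binEntropy (bconv a p1)) / Real.log 2 := by
    refine h2'.trans ?_
    rw [hh, hh]
    gcongr
    exact binEnt_mono hb1 hbb hb2'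
  set r1 := (1 - θ) * R.1 * Real.log 2 with hr1
  set r2 := (1 - θ) * R.2 * Real.log 2 with hr2
  obtain ⟨N1, H1⟩ := test_exists (a := 1/2) (p := bconv a p1) (by norm_num) (by norm_num) hb1 (by linarith) r2
    (show 0 < ε / 3 by linarith)
  obtain ⟨N2, H2⟩ := test_exists (a := 1/2) (p := bconv a p2) (by norm_num) (by norm_num) hb2 (by linarith) r2
    (show 0 < ε / 3 by linarith)
  obtain ⟨N3, H3⟩ := test_exists (a := a) (p := p1) ha0 (by linarith) hp1 (by linarith) r1
    (show 0 < ε / 3 by linarith)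
  set n := N1 + N2 + N3 + 1 with hn
  set k1 := cs n r1 with hk1
  set k2 := cs n r2 with hk2
  have pk1 : 0 < k1 := cs_pos _ _
  have pk2 : 0 < k2 := cs_pos _ _
  have pk1' : (0:ℝ) < k1 := by exact_mod_cast pk1
  have pk2' : (0:ℝ) < k2 := by exact_mod_cast pk2
  obtain ⟨T1, hT1⟩ := H1 n (by omega) (k2 - 1) (cs_ge _ _) (cs_cond hR2 hθ0 h2'' n)
  obtain ⟨T2, hT2⟩ := H2 n (by omega) (k2 - 1) (cs_ge _ _) (cs_cond hR2 hθ0 h2' n)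
  obtain ⟨T3, hT3⟩ := H3 n (by omega) (k1 - 1) (cs_ge _ _) (cs_cond hR1 hθ0 h1 n)
  have ne1 : Nonempty (Fin k1) := ⟨⟨0, pk1⟩⟩
  have ne2 : Nonempty (Fin k2) := ⟨⟨0, pk2⟩⟩
  set wU : (Fin k2 → Fin n → Bool) → ℝ := cw (bk (1/2) n (zw n)) with hwU
  set wV : (Fin k1 → Fin n → Bool) → ℝ := cw (bk a n (zw n)) with hwV
  have wU0 : ∀ U, 0 ≤ wU U := fun U => cw_nonneg _ (fun _ => bk_nonneg (by norm_num) (by norm_num) _ _) U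
  have wV0 : ∀ V, 0 ≤ wV V := fun V => cw_nonneg _ (fun _ => bk_nonneg ha0 (by linarith) _ _) V
  have wU1 : ∑ U, wU U = 1 := cw_sum _ (bk_sum _ _)
  have wV1 : ∑ V, wV V = 1 := cw_sum _ (bk_sum _ _)
  -- decoding of the cloud centre
  have cloud : ∀ (p : ℝ) (T : (Fin n → Bool) → (Fin n → Bool) → Prop), 0 ≤ bconv a p → bconv a p ≤ 1 →
      failP (1/2) (bconv a p) n T + ((k2:ℝ) - 1) * passP (1/2) (bconv a p) n T ≤ ε / 3 →
      ∀ (m1 : Fin k1) (m2 : Fin k2), ∑ U, ∑ V, wU U * wV V * ∑ y, bk p n (xr (U m2) (V m1)) y *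
        (if dec T univ U y = m2 then 0 else 1) ≤ ε / 3 := by
    intro p T hb0 hb1 hT m1 m2
    refine le_trans (le_of_eq ?_) ((rc_bk (ι := Fin k2) (a := 1/2) (by norm_num) (by norm_num) hb0 hb1 T univ (mem_univ m2)).trans ?_)
    · apply sum_congr rfl; intro U _
      simp only [mul_assoc]
      rw [← mul_sum]
      congr 1
      rw [hwV, cw_one _ (bk_sum _ _) m1 (fun v => ∑ y, bk p n (xr (U m2) v) y *
        (if dec T univ U y = m2 then 0 else 1))]
      exact xor_avg a p (U m2) _
    · simpa using hT
  have EA := cloud p2 T2 hb2 (by linarith) hT2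
  have EB := cloud p1 T1 hb1 (by linarith) hT1
  have EC : ∀ (m1 : Fin k1) (m2 : Fin k2), ∑ U, ∑ V, wU U * wV V * ∑ y, bk p1 n (xr (U m2) (V m1)) y *
        (if dec T3 univ V (xr (U m2) y) = m1 then 0 else 1) ≤ ε / 3 := by
    intro m1 m2
    have hb := (rc_bk (ι := Fin k1) ha0 (by linarith) hp1 (by linarith) T3 univ (mem_univ m1)).trans (by simpa using hT3)
    have : ∀ U : Fin k2 → Fin n → Bool, ∑ V, wU U * wV V * ∑ y, bk p1 n (xr (U m2) (V m1)) y *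
        (if dec T3 univ V (xr (U m2) y) = m1 then 0 else 1) ≤ wU U * (ε / 3) := by
      intro U
      simp only [mul_assoc]
      rw [← mul_sum]
      refine mul_le_mul_of_nonneg_left (le_trans (le_of_eq ?_) hb) (wU0 U)
      apply sum_congr rfl; intro V _
      congr 1
      exact xor_shift p1 (U m2) (V m1) (fun y => if dec T3 univ V y = m1 then 0 else 1)
    refine (sum_le_sum fun U _ => this U).trans ?_
    rw [← sum_mul, wU1, one_mul]
  -- random coding
  obtain ⟨⟨U, V⟩, hUV⟩ := exists_of_avg (C := (Fin k2 → Fin n → Bool) × (Fin k1 → Fin n → Bool))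
    (fun c => wU c.1 * wV c.2)
    (fun c => errP0 W n k1 k2 (fun m => xr (c.1 m.2) (c.2 m.1))
      (fun y => dec T3 univ c.2 (xr (c.1 (dec T1 univ c.1 y)) y)) (fun y => dec T2 univ c.1 y))
    (fun c => mul_nonneg (wU0 _) (wV0 _))
    (by rw [Fintype.sum_prod_type]; simp only [← mul_sum, wV1, mul_one, wU1])
    (ε := ε) (by
      have bound : ∀ (U : Fin k2 → Fin n → Bool) (V : Fin k1 → Fin n → Bool), 
        errP0 W n k1 k2 (fun m => xr (U m.2) (V m.1))
        (fun y => dec T3 univ V (xr (U (dec T1 univ U y)) y)) (fun y => dec T2 univ U y) ≤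
        (1 : ℝ) / ((k1 : ℝ) * (k2 : ℝ)) * ∑ m : Fin k1 × Fin k2,
          (∑ y, bk p2 n (xr (U m.2) (V m.1)) y * (if dec T2 univ U y = m.2 then 0 else 1) +
          ∑ y, bk p1 n (xr (U m.2) (V m.1)) y * (if dec T1 univ U y = m.2 then 0 else 1) +
          ∑ y, bk p1 n (xr (U m.2) (V m.1)) y * (if dec T3 univ V (xr (U m.2) y) = m.1 then 0 else 1)) := by
        intro U V
        unfold errP0
        refine mul_le_mul_of_nonneg_left ?_ (by positivity)
        apply sum_le_sum
        rintro ⟨m1, m2⟩ _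
        refine (err_le hW _ (fun y => dec T3 univ V (xr (U (dec T1 univ U y.1)) y.1) = m1)
          (fun y => dec T2 univ U y.2 = m2)).trans ?_
        rw [sum_marg1 hm1 _ (fun y => if dec T3 univ V (xr (U (dec T1 univ U y)) y) = m1 then 0 else 1),
          sum_marg2 hm2 _ (fun y => if dec T2 univ U y = m2 then 0 else 1)]
        rw [add_comm, add_assoc]
        refine add_le_add le_rfl ?_
        rw [← sum_add_distrib]
        apply sum_le_sum; intro y _
        rw [← mul_add]
        refine mul_le_mul_of_nonneg_left ?_ (bk_nonneg hp1 (by linarith) _ _)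
        by_cases hd : dec T1 univ U y = m2
        · simp [hd]
        · rw [if_neg hd]
          split_ifs <;> norm_num
      refine (sum_le_sum fun c _ =>
        mul_le_mul_of_nonneg_left (bound c.1 c.2) (mul_nonneg (wU0 c.1) (wV0 c.2))).trans ?_
      refine avg_swap pk1 pk2 _ _ fun m => ?_
      simp only [mul_add, sum_add_distrib]
      rw [Fintype.sum_prod_type, Fintype.sum_prod_type, Fintype.sum_prod_type]
      exact le_trans (add_le_add (add_le_add (EA m.1 m.2) (EB m.1 m.2)) (EC m.1 m.2)) (by linarith))
  exact ⟨n, k1, k2, by omega, pk1, pk2, _, _, _, cs_rate (by omega) _, cs_rate (by omega) _, hUV⟩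

lemma ach_ii {p1 p2 : ℝ} (hp1 : 0 ≤ p1) (hp12 : p1 ≤ p2) (hp2 : p2 ≤ 1/2)
    {W : Bool → Bool × Bool → ℝ} (hW : IsChannel W)
    (hm1 : ∀ x y, margW1 W x y = BSCk p1 x y)
    (hm2 : ∀ x y, margW2 W x y = BSCk p2 x y) {R : ℝ × ℝ} (hR1 : 0 ≤ R.1) (hR2 : 0 ≤ R.2)
    (h2 : R.2 ≤ 1 - Hb p2) (h1 : R.1 + R.2 ≤ 1 - Hb p1)
    {θ : ℝ} (hθ0 : 0 < θ) (hθ1 : θ < 1) : Ach2 W ((1 - θ) * R.1, (1 - θ) * R.2) := by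
  have hl : 0 < Real.log 2 := Real.log_pos (by norm_num)
  refine ⟨mul_nonneg (by linarith) hR1, mul_nonneg (by linarith) hR2, fun ε hε => ?_⟩
  have hh : ∀ b, Real.binEntropy (bconv (1/2) b) = Real.log 2 := fun b => by
    rw [bconv_half, one_div, Real.binEntropy_two_inv]
  have h1' : R.1 + R.2 ≤ (Real.binEntropy (bconv (1/2) p1) - Real.binEntropy p1) / Real.log 2 := by
    rw [hh, sub_div, div_self hl.ne', ← Hb_eq]; exact h1
  have h2' : R.2 ≤ (Real.binEntropy (bconv (1/2) p2) - Real.binEntropy p2) / Real.log 2 := by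
    rw [hh, sub_div, div_self hl.ne', ← Hb_eq]; exact h2
  set r1 := (1 - θ) * R.1 * Real.log 2 with hr1
  set r2 := (1 - θ) * R.2 * Real.log 2 with hr2
  have hr10 : 0 ≤ r1 := mul_nonneg (mul_nonneg (by linarith) hR1) hl.le
  have hr20 : 0 ≤ r2 := mul_nonneg (mul_nonneg (by linarith) hR2) hl.le
  have hp11 : p1 ≤ 1 := by linarith
  have hp20 : 0 ≤ p2 := by linarith
  have hp21 : p2 ≤ 1 := by linarith
  obtain ⟨N1, H1⟩ := test_exists (a := 1/2) (p := p1) (by norm_num) (by norm_num) hp1 hp11 (r1 + r2)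
    (show 0 < ε / 2 by linarith)
  obtain ⟨N2, H2⟩ := test_exists (a := 1/2) (p := p2) (by norm_num) (by norm_num) hp20 hp21 r2
    (show 0 < ε / 2 by linarith)
  set n := N1 + N2 + 1 with hn
  set k1 := cs n r1 with hk1
  set k2 := cs n r2 with hk2
  have pk1 : 0 < k1 := cs_pos _ _
  have pk2 : 0 < k2 := cs_pos _ _
  have pk1' : (1:ℝ) ≤ k1 := by exact_mod_cast pk1
  have pk2' : (1:ℝ) ≤ k2 := by exact_mod_cast pk2
  obtain ⟨T1, hT1⟩ := H1 n (by omega) (k1 * k2 - 1) (by nlinarith) (by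
    rcases (add_nonneg hR1 hR2).eq_or_lt with h0 | h0
    · left
      have a1 : R.1 = 0 := by linarith
      have a2 : R.2 = 0 := by linarith
      simp [hk1, hk2, hr1, hr2, a1, a2, cs_zero]
    · right
      refine ⟨?_, ?_⟩
      · have := rate_strict h0 hθ0 h1'
        rw [hr1, hr2]; linarith
      · have c1 := cs_le n r1
        have c2 := cs_le n r2
        have e1 : 1 ≤ Real.exp (n * r1) := Real.one_le_exp (by positivity)
        have e2 : 1 ≤ Real.exp (n * r2) := Real.one_le_exp (by positivity)
        rw [mul_add, Real.exp_add]
        rw [← hk1] at c1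
        rw [← hk2] at c2
        have : (k1:ℝ) * k2 ≤ (Real.exp (n * r1) + 1) * (Real.exp (n * r2) + 1) := by
          apply mul_le_mul <;> linarith
        nlinarith)
  obtain ⟨T2, hT2⟩ := H2 n (by omega) (k2 - 1) (cs_ge _ _) (cs_cond hR2 hθ0 h2' n)
  have ne1 : Nonempty (Fin k1) := ⟨⟨0, pk1⟩⟩
  have ne2 : Nonempty (Fin k2) := ⟨⟨0, pk2⟩⟩
  set w : (Fin k1 × Fin k2 → Fin n → Bool) → ℝ := cw (bk (1/2) n (zw n)) with hw
  have w0 : ∀ c, 0 ≤ w c := fun c => cw_nonneg _ (fun _ => bk_nonneg (by norm_num) (by norm_num) _ _) c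
  have w1 : ∑ c, w c = 1 := cw_sum _ (bk_sum _ _)
  obtain ⟨c, hc⟩ := exists_of_avg w
    (fun c => errP2 W n k1 k2 c (fun y => (dec T1 univ c y).1)
      (fun y => (dec T2 (({y.2} : Finset (Fin k1)) ×ˢ (univ : Finset (Fin k2))) c y.1).2)) w0 w1 (ε := ε) (by
      have bound : ∀ c, errP2 W n k1 k2 c (fun y => (dec T1 univ c y).1)
        (fun y => (dec T2 (({y.2} : Finset (Fin k1)) ×ˢ (univ : Finset (Fin k2))) c y.1).2) ≤
        (1 : ℝ) / ((k1 : ℝ) * (k2 : ℝ)) * ∑ m : Fin k1 × Fin k2,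
          (∑ y, bk p1 n (c m) y * (if dec T1 univ c y = m then 0 else 1) +
          ∑ y, bk p2 n (c m) y * (if dec T2 (({m.1} : Finset (Fin k1)) ×ˢ (univ : Finset (Fin k2))) c y = m then 0 else 1)) := by
        intro c
        unfold errP2
        refine mul_le_mul_of_nonneg_left ?_ (by positivity)
        apply sum_le_sum
        rintro m _
        refine (err_le hW _ (fun y => (dec T1 univ c y.1).1 = m.1)
          (fun y => (dec T2 (({m.1} : Finset (Fin k1)) ×ˢ (univ : Finset (Fin k2))) c y.2).2 = m.2)).trans ?_
        rw [sum_marg1 hm1 _ (fun y => if (dec T1 univ c y).1 = m.1 then 0 else 1),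
          sum_marg2 hm2 _ (fun y => if (dec T2 (({m.1} : Finset (Fin k1)) ×ˢ (univ : Finset (Fin k2))) c y).2 = m.2 then 0 else 1)]
        refine add_le_add (sum_le_sum fun y _ => mul_le_mul_of_nonneg_left ?_ (bk_nonneg hp1 hp11 _ _))
          (sum_le_sum fun y _ => mul_le_mul_of_nonneg_left ?_ (bk_nonneg hp20 hp21 _ _))
        · by_cases hd : dec T1 univ c y = m
          · simp [hd]
          · rw [if_neg hd]; split_ifs <;> norm_num
        · by_cases hd : dec T2 (({m.1} : Finset (Fin k1)) ×ˢ (univ : Finset (Fin k2))) c y = m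
          · rw [hd]; simp
          · rw [if_neg hd]; split_ifs <;> norm_num
      refine (sum_le_sum fun c _ => mul_le_mul_of_nonneg_left (bound c) (w0 c)).trans ?_
      refine avg_swap pk1 pk2 _ _ fun m => ?_
      simp only [mul_add, sum_add_distrib]
      refine le_trans (add_le_add
        ((rc_bk (ι := Fin k1 × Fin k2) (a := 1/2) (by norm_num) (by norm_num) hp1 hp11 T1 univ (mem_univ m)).trans ?_)
        ((rc_bk (ι := Fin k1 × Fin k2) (a := 1/2) (by norm_num) (by norm_num) hp20 hp21 T2
          (({m.1} : Finset (Fin k1)) ×ˢ (univ : Finset (Fin k2))) (by simp)).trans ?_))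
        (le_of_eq (add_halves ε))
      · simpa using hT1
      · simpa using hT2)
  exact ⟨n, k1, k2, by omega, pk1, pk2, _, _, _, cs_rate (by omega) _, cs_rate (by omega) _, hc⟩

lemma mem_closure_scale {S : Set (ℝ × ℝ)} {R : ℝ × ℝ}
    (h : ∀ θ : ℝ, 0 < θ → θ < 1 → ((1 - θ) * R.1, (1 - θ) * R.2) ∈ S) : R ∈ closure S := by
  have g : Filter.Tendsto (fun θ : ℝ => ((1 - θ) * R.1, (1 - θ) * R.2)) (nhdsWithin 0 (Set.Ioi 0))
      (nhds ((1 - 0) * R.1, (1 - 0) * R.2)) :=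
    (Continuous.tendsto (f := fun θ : ℝ => ((1 - θ) * R.1, (1 - θ) * R.2)) (by fun_prop) 0).mono_left nhdsWithin_le_nhds
  simp only [sub_zero, one_mul] at g
  refine mem_closure_of_tendsto g ?_
  filter_upwards [Ioo_mem_nhdsGT (show (0:ℝ) < 1 by norm_num)] with e he
  exact h e he.1 he.2

theorem bsbc_final
    (p1 p2 : ℝ) (hp1 : 0 ≤ p1) (hp12 : p1 ≤ p2) (hp2 : p2 ≤ 1/2)
    (W : Bool → Bool × Bool → ℝ) (hW : IsChannel W)
    (hm1 : ∀ x y, margW1 W x y = BSCk p1 x y)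
    (hm2 : ∀ x y, margW2 W x y = BSCk p2 x y) :
    Cap1 W = Cap W ∧
    Cap W = CBSBC p1 p2 ∧
    Cap2 W = {R : ℝ × ℝ | 0 ≤ R.1 ∧ 0 ≤ R.2 ∧
      R.2 ≤ 1 - Hb p2 ∧ R.1 + R.2 ≤ 1 - Hb p1} := by
  have a1 : Cap W ⊆ Cap1 W := closure_mono fun R h => ach0_ach1 h
  have a2 : Cap1 W ⊆ CBSBC p1 p2 :=
    closure_minimal (fun R h => conv1 hp1 hp12 hp2 hW hm1 hm2 h) (CBSBC_closed p1 p2)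
  have a3 : CBSBC p1 p2 ⊆ Cap W := fun R h =>
    mem_closure_scale fun θ h0 h1 => ach_i hp1 hp12 hp2 hW hm1 hm2 h h0 h1
  refine ⟨(a2.trans a3).antisymm a1, (a1.trans a2).antisymm a3, Set.Subset.antisymm ?_ ?_⟩
  · refine closure_minimal (fun R h => ?_) (region2_closed p1 p2)
    obtain ⟨b1, b2⟩ := conv2 hp1 hp12 hp2 hW hm1 hm2 h
    exact ⟨h.1, h.2.1, b1, b2⟩
  · rintro R ⟨c1, c2, c3, c4⟩
    exact mem_closure_scale fun θ h0 h1 => ach_ii hp1 hp12 hp2 hW hm1 hm2 c1 c2 c3 c4 h0 h1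

/-- **Proposition 4.** For `BS-BC(p₁,p₂)` with `0 ≤ p₁ ≤ p₂ ≤ 1/2`:
`𝒞₁ = 𝒞 = 𝒞(BS-BC(p₁,p₂))` and
`𝒞₂ = {(R1,R2) ∈ ℝ²₊ : R2 ≤ 1 − H_b(p₂), R1+R2 ≤ 1 − H_b(p₁)}`. -/
theorem bsbc_capacity_regions
    (p1 p2 : ℝ) (hp1 : 0 ≤ p1) (hp12 : p1 ≤ p2) (hp2 : p2 ≤ 1/2)
    (W : Bool → Bool × Bool → ℝ) (hW : IsChannel W)
    (hm1 : ∀ x y, margW1 W x y = BSCk p1 x y)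
    (hm2 : ∀ x y, margW2 W x y = BSCk p2 x y) :
    Cap1 W = Cap W ∧
    Cap W = CBSBC p1 p2 ∧
    Cap2 W = {R : ℝ × ℝ | 0 ≤ R.1 ∧ 0 ≤ R.2 ∧
      R.2 ≤ 1 - Hb p2 ∧ R.1 + R.2 ≤ 1 - Hb p1} := by
  exact bsbc_final p1 p2 hp1 hp12 hp2 W hW hm1 hm2

end
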